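/- arXiv:1810.07285 — 3 statements merged into one kernel-verified Lean document; each statement's English description precedes it below -/
import Mathlib

section
/- For every semigroup morphism φ: Σ⁺ → S from the nonempty words over a finite alphabet Σ to a finite semigroup S, there exists a φ-good automaton. -/
/-- A (nondeterministic) Büchi/finite-word automaton with ordered states. -/
structure Auto (A : Type) where
  Q : Type
  fin : Fintype Q
  lin : LinearOrder Q
  trans : Q → A → Q → Prop
  init : Q
  final : Set Q
  rep : Set Q

namespace Auto

variable {A : Type} (M : Auto A)

/-- The strict order on states. -/
def slt (p q : M.Q) : Prop := M.lin.lt p q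

/-- `pathIn X p w q`: nonempty word `w` labels a run from `p` to `q`
with all intermediate states in `X`. -/
def pathIn (X : Set M.Q) : M.Q → List A → M.Q → Prop
  | _, [], _ => False
  | p, [a], q => M.trans p a q
  | p, a :: b :: w, q => ∃ r, r ∈ X ∧ M.trans p a r ∧ pathIn X r (b :: w) q

/-- `L_{p,X,q}`. -/
def Lset (X : Set M.Q) (p q : M.Q) : Set (List A) := {w | M.pathIn X p w q}

/-- `↓q`. -/
def below (q : M.Q) : Set M.Q := {p | M.slt p q}

/-- `L_q = L_{q,↓q,q}`. -/
def Lq (q : M.Q) : Set (List A) := M.Lset (M.below q) q q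

/-- Accepting run on a nonempty finite word: `ρ i` is the state after reading `i` letters. -/
def FinAccRun (w : List A) (ρ : Fin (w.length + 1) → M.Q) : Prop :=
  ρ 0 = M.init ∧
  (∀ i : Fin w.length, M.trans (ρ i.castSucc) (w.get i) (ρ i.succ)) ∧
  ρ (Fin.last w.length) ∈ M.final

/-- Accepting (Büchi) run on an infinite word. -/
def InfAccRun (w : ℕ → A) (ρ : ℕ → M.Q) : Prop :=
  ρ 0 = M.init ∧ (∀ i, M.trans (ρ i) (w i) (ρ (i + 1))) ∧
  ∀ n, ∃ m, n ≤ m ∧ ρ m ∈ M.rep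

/-- (G1): every finite or infinite word has exactly one accepting run. -/
def G1 : Prop :=
  (∀ w : List A, w ≠ [] → ∃! ρ : Fin (w.length + 1) → M.Q, M.FinAccRun w ρ) ∧
  (∀ w : ℕ → A, ∃! ρ : ℕ → M.Q, M.InfAccRun w ρ)

/-- (G2): each `L_q` is mapped by `φ` to a single idempotent of `S`. -/
def G2 {S : Type} [Semigroup S] (φ : List A → S) : Prop :=
  ∀ q : M.Q, ∃ e : S, e * e = e ∧ ∀ w ∈ M.Lq q, φ w = e

/-- (G3): the initial state has no incoming transitions and is maximal. -/
def G3 : Prop :=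
  (∀ p a, ¬ M.trans p a M.init) ∧ ∀ q : M.Q, q ≠ M.init → M.slt q M.init

/-- `φ`-weakly-good automaton. -/
def WeaklyGood {S : Type} [Semigroup S] (φ : List A → S) : Prop :=
  M.G1 ∧ M.G2 φ ∧ M.G3

/-- (G4) and `φ`-goodness. -/
def Good {S : Type} [Semigroup S] (φ : List A → S) : Prop :=
  M.WeaklyGood φ ∧
  ∃ f : M.Q, M.final = {f} ∧ (∀ a q, ¬ M.trans f a q) ∧
    M.slt f M.init ∧ ∀ q : M.Q, q ≠ M.init → q ≠ f → M.slt q f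

def Deterministic : Prop := ∀ p a q q', M.trans p a q → M.trans p a q' → q = q'

def Complete : Prop := ∀ p a, ∃ q, M.trans p a q

end Auto

/-! ### Partial products and left ideals -/

/-- The product `c * s` where `none` stands for an adjoined unit. -/
def optMul {S : Type} [Semigroup S] (c : Option S) (s : S) : S :=
  c.elim s (· * s)

theorem optMul_mul {S : Type} [Semigroup S] (c : Option S) (s t : S) :
    optMul c s * t = optMul c (s * t) := by
  cases c <;> simp [optMul, mul_assoc]

/-- The left ideal generated by `s`. -/
def leftIdeal {S : Type} [Semigroup S] (s : S) : Set S :=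
  Set.range fun c : Option S => optMul c s

/-- The size of the left ideal generated by `s`. -/
noncomputable def leftRank {S : Type} [Semigroup S] (s : S) : ℕ :=
  (leftIdeal s).ncard

theorem self_mem_leftIdeal {S : Type} [Semigroup S] (s : S) : s ∈ leftIdeal s :=
  ⟨none, rfl⟩

theorem leftRank_pos {S : Type} [Semigroup S] [Finite S] (s : S) : 0 < leftRank s :=
  (Set.ncard_pos (Set.toFinite _)).2 ⟨s, self_mem_leftIdeal s⟩

theorem leftRank_le_card {S : Type} [Semigroup S] [Finite S] (s : S) :
    leftRank s ≤ Nat.card S :=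
  Set.ncard_le_card _

theorem leftRank_mul_le {S : Type} [Semigroup S] [Finite S] (s t : S) :
    leftRank (s * t) ≤ leftRank s := by
  have h : leftIdeal (s * t) = (· * t) '' leftIdeal s := by
    ext x
    simp [leftIdeal, optMul_mul]
  rw [leftRank, h]
  exact Set.ncard_image_le (Set.toFinite _)

/-- If `t * s = t` and the left ideal of `s` is not larger than that of `t`, then `s` lies in
the left ideal of `t`, hence `s` absorbs on the right whatever `t` absorbs. -/
theorem mul_eq_left_of_leftRank_le {S : Type} [Semigroup S] [Finite S] {t s u : S}
    (hs : t * s = t) (hle : leftRank s ≤ leftRank t) (hst : t * u = t) : s * u = s := by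
  have hsub : leftIdeal t ⊆ leftIdeal s := by
    rintro _ ⟨c, rfl⟩
    refine ⟨some (optMul c t), ?_⟩
    change optMul c t * s = optMul c t
    rw [optMul_mul, hs]
  have heq : leftIdeal t = leftIdeal s :=
    Set.eq_of_subset_of_ncard_le hsub hle (Set.toFinite _)
  obtain ⟨c, hc⟩ : s ∈ leftIdeal t := heq ▸ self_mem_leftIdeal s
  change optMul c t = s at hc
  rw [← hc, optMul_mul, hst]

/-- A nonempty finite semigroup has an idempotent. -/
theorem exists_idempotent {S : Type} [Semigroup S] [Finite S] (s : S) : ∃ e : S, e * e = e := by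
  let _ : TopologicalSpace S := ⊥
  have : DiscreteTopology S := ⟨rfl⟩
  have : Nonempty S := ⟨s⟩
  exact exists_idempotent_of_compact_t2_of_continuous_mul_left fun _ =>
    continuous_of_discreteTopology

/-! ### A deterministic forward Ramsey split -/

/-- Reading `v` from `c` in the deterministic transition system `δ` ends in `d`, and the
intermediate states have rank at most that of `d`. -/
def ReturnsTo {A D : Type} (δ : D → A → D) (rk : D → ℕ) (d : D) : D → List A → Prop
  | _, [] => False
  | c, [a] => δ c a = d
  | c, a :: b :: v => rk (δ c a) ≤ rk d ∧ ReturnsTo δ rk d (δ c a) (b :: v)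

/-- Every map from a finite type to `ℕ` is refined by an injective one. -/
theorem exists_injective_refining {D : Type} [Finite D] (f : D → ℕ) :
    ∃ rk : D → ℕ, Function.Injective rk ∧ ∀ c d, rk c ≤ rk d → f c ≤ f d := by
  obtain ⟨n, ⟨e⟩⟩ := Finite.exists_equiv_fin D
  have key : ∀ c d, n * f c + e c ≤ n * f d + e d → f c ≤ f d := by
    intro c d h
    by_contra! hlt
    have h1 : n * (f d + 1) ≤ n * f c := Nat.mul_le_mul_left n hlt
    have h2 := (e d).isLt
    rw [Nat.mul_add] at h1
    omega
  refine ⟨fun d => n * f d + e d, fun c d h => ?_, key⟩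
  have h1 := (key c d (le_of_eq h)).antisymm (key d c (ge_of_eq h))
  simp only [h1, Nat.add_left_cancel_iff] at h
  exact e.injective (Fin.ext h)

/-- One step of the hierarchical factorisation: the thread at level `k` is extended by the
letter `a`, unless some level `j ≤ k` has reached left rank at most `j`, in which case it is
restarted. -/
noncomputable def splitStep {A S : Type} [Semigroup S] (φ : List A → S)
    (T : Fin (Nat.card S + 1) → Option S) (a : A) : Fin (Nat.card S + 1) → Option S :=
  open Classical in
  fun k => if ∃ j ≤ k, leftRank (optMul (T j) (φ [a])) ≤ j then none
    else some (optMul (T k) (φ [a]))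

/-- The number of threads which are being restarted. -/
noncomputable def restartCount {S : Type} {n : ℕ} (T : Fin n → Option S) : ℕ :=
  {k | T k = none}.ncard

theorem splitStep_eq_none {A S : Type} [Semigroup S] (φ : List A → S)
    (T : Fin (Nat.card S + 1) → Option S) (a : A) (k : Fin (Nat.card S + 1)) :
    splitStep φ T a k = none ↔ ∃ j ≤ k, leftRank (optMul (T j) (φ [a])) ≤ j := by
  classical
  unfold splitStep
  split_ifs with h <;> simp [h]

theorem splitStep_of_ne_none {A S : Type} [Semigroup S] {φ : List A → S}
    {T : Fin (Nat.card S + 1) → Option S} {a : A} {k : Fin (Nat.card S + 1)}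
    (h : splitStep φ T a k ≠ none) :
    splitStep φ T a k = some (optMul (T k) (φ [a])) := by
  classical
  unfold splitStep at h ⊢
  split_ifs with h' <;> simp_all

theorem isUpperSet_splitStep {A S : Type} [Semigroup S] (φ : List A → S)
    (T : Fin (Nat.card S + 1) → Option S) (a : A) :
    IsUpperSet {k | splitStep φ T a k = none} := by
  intro k l hkl hk
  obtain ⟨j, hj, h⟩ := (splitStep_eq_none φ T a k).1 hk
  exact (splitStep_eq_none φ T a l).2 ⟨j, hj.trans hkl, h⟩

theorem ReturnsTo.exists_step {A D : Type} {δ : D → A → D} {rk : D → ℕ} {d : D} :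
    ∀ {c : D} {v : List A}, ReturnsTo δ rk d c v → ∃ c' a, δ c' a = d
  | _, [], h => h.elim
  | c, [a], h => ⟨c, a, h⟩
  | _, _ :: _ :: _, h => h.2.exists_step

/-- The first step of a return to `d`, followed by a possibly empty return. -/
theorem ReturnsTo.head {A D : Type} {δ : D → A → D} {rk : D → ℕ} {d c : D} {a : A}
    {v : List A} (h : ReturnsTo δ rk d c (a :: v)) :
    rk (δ c a) ≤ rk d ∧ ((v = [] ∧ δ c a = d) ∨ (v ≠ [] ∧ ReturnsTo δ rk d (δ c a) v)) := by
  cases v with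
  | nil =>
    have h' : δ c a = d := h
    simp [h']
  | cons b v => exact ⟨h.1, Or.inr ⟨by simp, h.2⟩⟩

theorem splitStep_ne_none_of_restartCount_le {A S : Type} [Semigroup S] (φ : List A → S)
    {T T' : Fin (Nat.card S + 1) → Option S} {a a' : A} {k : Fin (Nat.card S + 1)}
    (h : restartCount (splitStep φ T a) ≤ restartCount (splitStep φ T' a'))
    (hk : splitStep φ T' a' k ≠ none) : splitStep φ T a k ≠ none := by
  rcases (isUpperSet_splitStep φ T a).total (isUpperSet_splitStep φ T' a') with hs | hs
  · exact fun h' => hk (hs h')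
  · exact fun h' =>
      hk ((Set.ext_iff.1 (Set.eq_of_subset_of_ncard_le hs h (Set.toFinite _)) k).2 h')

theorem ReturnsTo.thread_mul {A S : Type} [Semigroup S] {φ : List A → S}
    (hφ : ∀ u v : List A, u ≠ [] → v ≠ [] → φ (u ++ v) = φ u * φ v)
    {rk : (Fin (Nat.card S + 1) → Option S) → ℕ}
    (hrk : ∀ c d, rk c ≤ rk d → restartCount c ≤ restartCount d)
    {d : Fin (Nat.card S + 1) → Option S} {k : Fin (Nat.card S + 1)} (hk : d k ≠ none) :
    ∀ {v : List A} {c : Fin (Nat.card S + 1) → Option S},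
      ReturnsTo (splitStep φ) rk d c v → d k = some (optMul (c k) (φ v))
  | [], _, h => h.elim
  | a :: v, c, h => by
    obtain ⟨c', a', hd⟩ := h.exists_step
    obtain ⟨hle, ⟨rfl, h1⟩ | ⟨hv, h1⟩⟩ := h.head
    · subst h1
      exact splitStep_of_ne_none hk
    · have h2 := h1.thread_mul hφ hrk hk
      have h3 : splitStep φ c a k ≠ none := by
        subst hd
        exact splitStep_ne_none_of_restartCount_le φ (hrk _ _ hle) hk
      rw [h2, splitStep_of_ne_none h3, show a :: v = [a] ++ v from rfl, hφ _ _ (by simp) hv,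
        ← optMul_mul]
      rfl

theorem ReturnsTo.leftRank_le {A S : Type} [Semigroup S] [Finite S] {φ : List A → S}
    (hφ : ∀ u v : List A, u ≠ [] → v ≠ [] → φ (u ++ v) = φ u * φ v)
    {rk : (Fin (Nat.card S + 1) → Option S) → ℕ}
    (hrk : ∀ c d, rk c ≤ rk d → restartCount c ≤ restartCount d)
    {d : Fin (Nat.card S + 1) → Option S} {k : Fin (Nat.card S + 1)} (hk : d k = none)
    (hlt : ∀ j < k, d j ≠ none) :
    ∀ {v : List A} {c : Fin (Nat.card S + 1) → Option S},
      ReturnsTo (splitStep φ) rk d c v → leftRank (optMul (c k) (φ v)) ≤ k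
  | [], _, h => h.elim
  | a :: v, c, h => by
    obtain ⟨c', a', hd⟩ := h.exists_step
    obtain ⟨hle, h1⟩ := h.head
    have hcut : splitStep φ c a k = none → leftRank (optMul (c k) (φ [a])) ≤ k := by
      intro h2
      obtain ⟨j, hj, h3⟩ := (splitStep_eq_none φ c a k).1 h2
      rcases hj.eq_or_lt with rfl | hj
      · exact h3
      · have h4 := hlt j hj
        subst hd
        exact absurd ((splitStep_eq_none φ c a j).2 ⟨j, le_rfl, h3⟩)
          (splitStep_ne_none_of_restartCount_le φ (hrk _ _ hle) h4)
    obtain ⟨rfl, h1⟩ | ⟨hv, h1⟩ := h1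
    · exact hcut (h1 ▸ hk)
    · rw [show a :: v = [a] ++ v from rfl, hφ _ _ (by simp) hv, ← optMul_mul]
      by_cases h2 : splitStep φ c a k = none
      · exact (leftRank_mul_le _ _).trans (hcut h2)
      · have h3 := h1.leftRank_le hφ hrk hk hlt
        rwa [splitStep_of_ne_none h2] at h3

/-- For every morphism to a finite semigroup there is a deterministic transition system with
ranked states for which consecutive returns to a state `d` through states of rank at most that
of `d` satisfy the forward Ramsey property. -/
theorem exists_deterministic_split {A S : Type} [Semigroup S] [Finite S] (φ : List A → S)
    (hφ : ∀ u v : List A, u ≠ [] → v ≠ [] → φ (u ++ v) = φ u * φ v) :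
    ∃ (D : Type) (_ : Finite D) (_ : Nonempty D) (rk : D → ℕ) (_ : Function.Injective rk)
      (δ : D → A → D), ∀ d v v', ReturnsTo δ rk d d v → ReturnsTo δ rk d d v' →
        φ v * φ v' = φ v := by
  obtain ⟨rk, hinj, hrk⟩ :=
    exists_injective_refining (restartCount (S := S) (n := Nat.card S + 1))
  refine ⟨Fin (Nat.card S + 1) → Option S, inferInstance, inferInstance, rk, hinj,
    splitStep φ, fun d v v' hv hret => ?_⟩
  obtain ⟨c, a, hd⟩ := hv.exists_step
  have hlast : d (Fin.last _) = none := by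
    subst hd
    exact (splitStep_eq_none _ _ _ _).2 ⟨Fin.last _, le_rfl, by simpa using leftRank_le_card _⟩
  obtain ⟨k, hk, hlt⟩ : ∃ k, d k = none ∧ ∀ j < k, d j ≠ none :=
    ⟨_, WellFounded.min_mem wellFounded_lt {k | d k = none} ⟨_, hlast⟩,
      fun j hj h => WellFounded.not_lt_min wellFounded_lt {k | d k = none} h hj⟩
  have hk0 : k ≠ 0 := by
    rintro rfl
    subst hd
    obtain ⟨j, hj, h⟩ := (splitStep_eq_none _ _ _ _).1 hk
    have := leftRank_pos (optMul (c j) (φ [a]))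
    simp only [Fin.le_zero_iff] at hj
    subst hj
    simp at h
    omega
  obtain ⟨j, rfl⟩ := Fin.exists_succ_eq.2 hk0
  have hj : d j.castSucc ≠ none := hlt _ j.castSucc_lt_succ
  obtain ⟨t, ht⟩ := Option.ne_none_iff_exists'.1 hj
  have hmul : ∀ u, ReturnsTo (splitStep φ) rk d d u → t * φ u = t := by
    intro u hu
    have := hu.thread_mul hφ hrk hj
    rw [ht] at this
    exact (Option.some.inj this).symm
  have hlow : leftRank (φ v) ≤ j.succ := by
    have := hv.leftRank_le hφ hrk hk hlt
    rwa [hk] at this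
  have hhigh : j + 1 ≤ leftRank t := by
    subst hd
    have h1 := hj
    rw [ne_eq, splitStep_eq_none] at h1
    rw [splitStep_of_ne_none hj, Option.some.injEq] at ht
    by_contra! h2
    refine h1 ⟨_, le_rfl, ?_⟩
    rw [ht]
    simpa using Nat.le_of_lt_succ h2
  exact mul_eq_left_of_leftRank_le (hmul v hv) (hlow.trans (by simpa using hhigh)) (hmul v' hret)

/-! ### Predicting the next return -/

/-- A state `d` of the deterministic system, with pending predictions: the entry at `e` holds
the value predicted for the next return to `e` (`none` if no return is predicted) and the
value read since the last visit of `e`. -/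
abbrev GuessState (D S : Type) : Type := D × (D → Option (Option S × Option S))

section Guess

variable {A S D : Type} [Semigroup S] (φ : List A → S) (δ : D → A → D) (rk : D → ℕ) (d₀ : D)

/-- Read the letter `a` and record the prediction `g` for the new state. -/
noncomputable def guessNext (x : GuessState D S) (a : A) (g : Option S) : GuessState D S :=
  open Classical in
  (δ x.1 a, fun e =>
    if e = δ x.1 a then some (g, none)
    else if rk e ≤ rk (δ x.1 a) then none
    else (x.2 e).map fun p => (p.1, some (optMul p.2 (φ [a]))))

/-- The predictions resolved by reading `a` are correct. -/
def GuessOk (x : GuessState D S) (a : A) : Prop :=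
  ∀ e, ∀ p ∈ x.2 e, (e = δ x.1 a → p.1 = some (optMul p.2 (φ [a]))) ∧
    (rk e < rk (δ x.1 a) → p.1 = none)

/-- Transitions of the predicting automaton. -/
def GuessStep (x : GuessState D S) (a : A) (y : GuessState D S) : Prop :=
  GuessOk φ δ rk x a ∧ ∃ g, y = guessNext φ δ rk x a g

/-- No pending return is predicted. -/
def GuessFinal (x : GuessState D S) : Prop := ∀ e, ∀ p ∈ x.2 e, p.1 = none

/-- No return to a state of rank higher than the current one is predicted. -/
def GuessRep (x : GuessState D S) : Prop :=
  ∀ e, rk x.1 < rk e → ∀ p ∈ x.2 e, p.1 = none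

/-- The initial state, without pending predictions. -/
def guessInit : GuessState D S := (d₀, fun _ => none)

/-- The deterministic run on `w`. -/
def detRun (w : ℕ → A) : ℕ → D
  | 0 => d₀
  | i + 1 => δ (detRun w i) (w i)

/-- The value of the `k` letters of `w` from position `j` on. -/
def factorValue (w : ℕ → A) (j : ℕ) : ℕ → Option S
  | 0 => none
  | k + 1 => some (optMul (factorValue w j k) (φ [w (j + k)]))

/-- The correct prediction at position `j` of the word `w` with set of positions `dom`. -/
noncomputable def trueGuess (w : ℕ → A) (dom : ℕ → Prop) (j : ℕ) : Option S :=
  open Classical in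
  if h : ∃ m, j < m ∧ dom m ∧ rk (detRun δ d₀ w j) ≤ rk (detRun δ d₀ w m) then
    if detRun δ d₀ w (Nat.find h) = detRun δ d₀ w j then
      factorValue φ w j (Nat.find h - j)
    else none
  else none

/-- The run with correct predictions. -/
noncomputable def canonicalRun (w : ℕ → A) (dom : ℕ → Prop) : ℕ → GuessState D S
  | 0 => guessInit d₀
  | i + 1 => guessNext φ δ rk (canonicalRun w dom i) (w i) (trueGuess φ δ rk d₀ w dom (i + 1))

variable {φ δ rk d₀}

theorem guessNext_self (x : GuessState D S) (a : A) (g : Option S) :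
    (guessNext φ δ rk x a g).2 (δ x.1 a) = some (g, none) := by
  simp [guessNext]

theorem guessNext_of_lt (x : GuessState D S) (a : A) (g : Option S) {e : D}
    (h : rk (δ x.1 a) < rk e) :
    (guessNext φ δ rk x a g).2 e =
      (x.2 e).map fun p => (p.1, some (optMul p.2 (φ [a]))) := by
  have h1 : e ≠ δ x.1 a := by rintro rfl; exact h.false
  simp [guessNext, h1, h]

theorem guessNext_eq_some {x : GuessState D S} {a : A} {g : Option S} {e : D}
    {p : Option S × Option S} (h : p ∈ (guessNext φ δ rk x a g).2 e) :
    (e = δ x.1 a ∧ p = (g, none)) ∨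
      (rk (δ x.1 a) < rk e ∧ ∃ p' ∈ x.2 e, p = (p'.1, some (optMul p'.2 (φ [a])))) := by
  classical
  simp only [guessNext, Option.mem_def] at h
  split_ifs at h with h1 h2
  · exact Or.inl ⟨h1, (Option.some.inj h).symm⟩
  · obtain ⟨p', hp', rfl⟩ := Option.map_eq_some_iff.1 h
    exact Or.inr ⟨not_le.1 h2, p', hp', rfl⟩

theorem canonicalRun_fst (w : ℕ → A) (dom : ℕ → Prop) (i : ℕ) :
    (canonicalRun φ δ rk d₀ w dom i).1 = detRun δ d₀ w i := by
  induction i with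
  | zero => rfl
  | succ i ih => rw [canonicalRun, guessNext, detRun, ih]

/-- The pending predictions of the canonical run are the correct ones. -/
theorem pending_canonicalRun (w : ℕ → A) (dom : ℕ → Prop) (i : ℕ) (e : D)
    (p : Option S × Option S) (hp : p ∈ (canonicalRun φ δ rk d₀ w dom i).2 e) :
    ∃ j k, i = j + k ∧ detRun δ d₀ w j = e ∧
      (∀ m, j < m → m ≤ i → rk (detRun δ d₀ w m) < rk e) ∧
      p = (trueGuess φ δ rk d₀ w dom j, factorValue φ w j k) := by
  induction i generalizing p with
  | zero => cases hp
  | succ i ih =>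
    rw [canonicalRun] at hp
    have hd : δ (canonicalRun φ δ rk d₀ w dom i).1 (w i) = detRun δ d₀ w (i + 1) := by
      rw [canonicalRun_fst, detRun]
    rcases guessNext_eq_some hp with ⟨he, rfl⟩ | ⟨he, p', hp', rfl⟩
    · exact ⟨i + 1, 0, rfl, by rw [he, hd], fun m _ _ => by omega, rfl⟩
    · obtain ⟨j, k, rfl, hj, hm, rfl⟩ := ih p' hp'
      refine ⟨j, k + 1, rfl, hj, fun m h1 h2 => ?_, rfl⟩
      rcases h2.eq_or_lt with rfl | h2
      · rwa [hd] at he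
      · exact hm m h1 (by omega)

theorem trueGuess_eq_none (w : ℕ → A) (dom : ℕ → Prop) (j : ℕ)
    (h : ∀ m, j < m → dom m → rk (detRun δ d₀ w m) < rk (detRun δ d₀ w j)) :
    trueGuess φ δ rk d₀ w dom j = none := by
  rw [trueGuess, dif_neg]
  rintro ⟨m, h1, h2, h3⟩
  exact absurd (h m h1 h2) (not_lt.2 h3)

theorem trueGuess_of_next (w : ℕ → A) (dom : ℕ → Prop) (j m : ℕ) (hjm : j < m) (hm : dom m)
    (hle : rk (detRun δ d₀ w j) ≤ rk (detRun δ d₀ w m))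
    (hlt : ∀ l, j < l → l < m → rk (detRun δ d₀ w l) < rk (detRun δ d₀ w j)) :
    (detRun δ d₀ w m = detRun δ d₀ w j →
      trueGuess φ δ rk d₀ w dom j = factorValue φ w j (m - j)) ∧
    (detRun δ d₀ w m ≠ detRun δ d₀ w j → trueGuess φ δ rk d₀ w dom j = none) := by
  classical
  have h : ∃ m, j < m ∧ dom m ∧ rk (detRun δ d₀ w j) ≤ rk (detRun δ d₀ w m) :=
    ⟨m, hjm, hm, hle⟩
  have hfind : Nat.find h = m :=
    (Nat.find_eq_iff h).2
      ⟨⟨hjm, hm, hle⟩, fun l hl h' => absurd (hlt l h'.1 hl) (not_lt.2 h'.2.2)⟩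
  rw [trueGuess, dif_pos h]
  constructor
  · intro h1
    rw [if_pos (by convert h1), ← hfind]
  · intro h1
    rw [if_neg (by convert h1)]

theorem guessOk_canonicalRun (w : ℕ → A) (dom : ℕ → Prop) (i : ℕ) (hi : dom (i + 1)) :
    GuessOk φ δ rk (canonicalRun φ δ rk d₀ w dom i) (w i) := by
  intro e p hp
  obtain ⟨j, k, rfl, rfl, hm, rfl⟩ := pending_canonicalRun w dom i e p hp
  rw [canonicalRun_fst, show δ (detRun δ d₀ w (j + k)) (w (j + k))
    = detRun δ d₀ w (j + k + 1) from rfl]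
  have key := fun hle => trueGuess_of_next (φ := φ) w dom j (j + k + 1) (by omega) hi hle
    fun l h1 h2 => hm l h1 (by omega)
  constructor
  · intro h
    rw [(key (by rw [h])).1 h.symm, show j + k + 1 - j = k + 1 by omega]
    rfl
  · intro h
    exact (key h.le).2 fun h' => by rw [h'] at h; exact h.false

theorem guessStep_canonicalRun (w : ℕ → A) (dom : ℕ → Prop) (i : ℕ) (hi : dom (i + 1)) :
    GuessStep φ δ rk (canonicalRun φ δ rk d₀ w dom i) (w i)
      (canonicalRun φ δ rk d₀ w dom (i + 1)) :=
  ⟨guessOk_canonicalRun w dom i hi, _, rfl⟩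

theorem guess_eq_none_of_pending (w : ℕ → A) (dom : ℕ → Prop) (i : ℕ) (e : D)
    (p : Option S × Option S) (hp : p ∈ (canonicalRun φ δ rk d₀ w dom i).2 e)
    (hi : ∀ m, i < m → dom m → rk (detRun δ d₀ w m) < rk e) : p.1 = none := by
  obtain ⟨j, k, -, rfl, hm, rfl⟩ := pending_canonicalRun w dom i e p hp
  refine trueGuess_eq_none w dom j fun m h1 h2 => ?_
  rcases le_or_gt m i with h | h
  · exact hm m h1 h
  · exact hi m h h2

/-- A run all of whose predictions are eventually resolved is the canonical run. -/
theorem eq_canonicalRun (hrk : Function.Injective rk) (w : ℕ → A) (dom : ℕ → Prop)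
    (hdom : ∀ i, dom (i + 1) → dom i) (x : ℕ → GuessState D S) (h0 : x 0 = guessInit d₀)
    (hstep : ∀ i, dom (i + 1) → GuessStep φ δ rk (x i) (w i) (x (i + 1)))
    (hacc : ∀ j, dom j → (∀ m, j < m → dom m → rk (x m).1 < rk (x j).1) →
      ∃ m, j ≤ m ∧ dom m ∧ ∀ p ∈ (x m).2 (x j).1, p.1 = none)
    (i : ℕ) (hi : dom i) : x i = canonicalRun φ δ rk d₀ w dom i := by
  have hdom' : ∀ k i, dom (i + k) → dom i := by
    intro k
    induction k with
    | zero => exact fun i h => h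
    | succ k ih => exact fun i h => ih i (hdom _ h)
  have hfst : ∀ i, dom i → (x i).1 = detRun δ d₀ w i := by
    intro i
    induction i with
    | zero => intro _; rw [h0]; rfl
    | succ i ih =>
      intro hi
      obtain ⟨-, g, hg⟩ := hstep i hi
      rw [hg, guessNext, detRun, ih (hdom i hi)]
  have hpers : ∀ j g, (x j).2 (x j).1 = some (g, none) → ∀ k, dom (j + k) →
      (∀ m, j < m → m ≤ j + k → rk (x m).1 < rk (x j).1) →
      (x (j + k)).2 (x j).1 = some (g, factorValue φ w j k) := by
    intro j g hj k
    induction k with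
    | zero => exact fun _ _ => hj
    | succ k ih =>
      intro hd hm
      have h1 := ih (hdom _ hd) fun m h1 h2 => hm m h1 (by omega)
      obtain ⟨-, g', hg'⟩ := hstep (j + k) hd
      have h2 := hm (j + (k + 1)) (by omega) le_rfl
      rw [← add_assoc] at h2 ⊢
      rw [hg'] at h2 ⊢
      rw [guessNext_of_lt _ _ _ h2, h1]
      rfl
  have hguess : ∀ j g, dom j → (x j).2 (x j).1 = some (g, none) →
      g = trueGuess φ δ rk d₀ w dom j := by
    classical
    intro j g hj hg
    by_cases h : ∃ m, j < m ∧ dom m ∧ rk (x j).1 ≤ rk (x m).1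
    · obtain ⟨h1, h2, h3⟩ := Nat.find_spec h
      have h4 : ∀ l, j < l → l < Nat.find h → rk (x l).1 < rk (x j).1 := by
        intro l hjl hl
        have hd : dom l := hdom' (Nat.find h - l) l (by rwa [Nat.add_sub_cancel' hl.le])
        by_contra! h'
        exact Nat.find_min h hl ⟨hjl, hd, h'⟩
      generalize Nat.find h = m at h1 h2 h3 h4
      obtain ⟨k, rfl⟩ : ∃ k, m = j + k + 1 := ⟨m - j - 1, by omega⟩
      have h5 := hpers j g hg k (hdom _ h2) fun l hl hl' => h4 l hl (by omega)
      obtain ⟨hok, g', hg'⟩ := hstep (j + k) h2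
      have h6 : (x (j + k + 1)).1 = δ (x (j + k)).1 (w (j + k)) := by rw [hg', guessNext]
      have h7 := hok _ _ h5
      rw [← h6] at h7
      have key := trueGuess_of_next (φ := φ) (rk := rk) (δ := δ) (d₀ := d₀) w dom j (j + k + 1)
        h1 h2 (by rwa [← hfst _ hj, ← hfst _ h2])
        (fun l hl hl' => by
          have hd : dom l := hdom' (j + k + 1 - l) l (by rwa [Nat.add_sub_cancel' hl'.le])
          rw [← hfst _ hj, ← hfst _ hd]
          exact h4 l hl hl')
      rw [← hfst _ hj, ← hfst _ h2] at key
      by_cases he : (x (j + k + 1)).1 = (x j).1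
      · rw [key.1 he, show j + k + 1 - j = k + 1 by omega]
        exact h7.1 he.symm
      · rw [key.2 he]
        exact h7.2 (lt_of_le_of_ne h3 fun h8 => he (hrk h8).symm)
    · push Not at h
      obtain ⟨m, h1, h2, h3⟩ := hacc j hj h
      obtain ⟨k, rfl⟩ := Nat.exists_eq_add_of_le h1
      have h4 := hpers j g hg k h2 fun l hl hl' => h l hl
        (hdom' (j + k - l) l (by rwa [Nat.add_sub_cancel' hl']))
      rw [trueGuess_eq_none]
      · exact h3 _ h4
      · intro l hl hl'
        rw [← hfst _ hj, ← hfst _ hl']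
        exact h l hl hl'
  induction i with
  | zero => exact h0
  | succ i ih =>
    obtain ⟨-, g, hg⟩ := hstep i hi
    rw [canonicalRun, ← ih (hdom i hi), ← hguess (i + 1) g hi, hg]
    rw [hg]
    exact guessNext_self _ _ _

/-- On an infinite word the canonical run satisfies the Büchi condition. -/
theorem guessRep_canonicalRun [Finite D] (w : ℕ → A) (n : ℕ) :
    ∃ m, n ≤ m ∧ GuessRep rk (canonicalRun φ δ rk d₀ w (fun _ => True) m) := by
  classical
  have hb : ∃ b n, ∀ m, n ≤ m → rk (detRun δ d₀ w m) ≤ b := by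
    obtain ⟨b, hb⟩ := (Set.finite_range rk).bddAbove
    exact ⟨b, 0, fun m _ => hb ⟨_, rfl⟩⟩
  obtain ⟨n₀, hn₀⟩ := Nat.find_spec hb
  have hmin : ∃ m, n + n₀ ≤ m ∧ Nat.find hb ≤ rk (detRun δ d₀ w m) := by
    by_contra! h
    have hpos := h _ le_rfl
    exact Nat.find_min hb (m := Nat.find hb - 1) (by omega)
      ⟨n + n₀, fun m hm => by have := h m hm; omega⟩
  obtain ⟨m, hm, hle⟩ := hmin
  refine ⟨m, by omega, fun e he p hp => guess_eq_none_of_pending w _ m e p hp fun m' h _ => ?_⟩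
  rw [canonicalRun_fst] at he
  have := hn₀ m' (by omega)
  omega

end Guess

/-! ### The good automaton -/

/-- Add an initial and a final state. -/
inductive PredState (X : Type) : Type
  | init : PredState X
  | mid : X → PredState X
  | fin : PredState X

namespace PredState

/-- The underlying state; `x₀` underlies the initial state and the final state has none. -/
def core {X : Type} (x₀ : X) : PredState X → Option X
  | init => some x₀
  | mid x => some x
  | fin => none

/-- Lift a run on inner states by replacing its first state with `init`. -/
def lift {X : Type} (x : ℕ → X) : ℕ → PredState X
  | 0 => .init
  | i + 1 => .mid (x (i + 1))

theorem core_lift {X : Type} (x : ℕ → X) (i : ℕ) :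
    (lift x i).core (x 0) = some (x i) := by
  cases i <;> rfl

/-- Like `lift`, but also replacing the state at position `n` with `fin`. -/
def liftFin {X : Type} (n : ℕ) (x : ℕ → X) (i : ℕ) : PredState X :=
  if i = n then fin else lift x i

theorem liftFin_self {X : Type} (n : ℕ) (x : ℕ → X) : liftFin n x n = fin := if_pos rfl

theorem liftFin_of_ne {X : Type} {n i : ℕ} (h : i ≠ n) (x : ℕ → X) :
    liftFin n x i = lift x i := if_neg h

/-- Inner states are ranked by their deterministic component, below `fin` and `init`. -/
noncomputable def rank {D S : Type} (rk : D → ℕ) : PredState (GuessState D S) → ℕ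
  | init => sSup (Set.range rk) + 2
  | mid x => rk x.1
  | fin => sSup (Set.range rk) + 1

instance {X : Type} [Finite X] : Finite (PredState X) :=
  Finite.of_injective
    (fun q : PredState X => match q with
      | init => (Sum.inl true : Bool ⊕ X)
      | mid x => Sum.inr x
      | fin => Sum.inl false)
    (by rintro (_ | _ | _) (_ | _ | _) h <;> simp_all)

theorem rank_lt_fin {D S : Type} [Finite D] (rk : D → ℕ) {q : PredState (GuessState D S)}
    (h : q ≠ init) (h' : q ≠ fin) : rank rk q < rank rk (fin : PredState (GuessState D S)) := by
  cases q with
  | init => exact (h rfl).elim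
  | fin => exact (h' rfl).elim
  | mid x => exact Nat.lt_succ_of_le (le_csSup (Set.finite_range rk).bddAbove ⟨x.1, rfl⟩)

theorem rank_lt_init {D S : Type} [Finite D] (rk : D → ℕ) {q : PredState (GuessState D S)}
    (h : q ≠ init) : rank rk q < rank rk (init : PredState (GuessState D S)) := by
  by_cases h' : q = fin
  · subst h'
    exact Nat.lt_succ_self _
  · exact (rank_lt_fin rk h h').trans (Nat.lt_succ_self _)

theorem key_lt_of_rank_lt {Q : Type} {f key : Q → ℕ} (h : ∀ c d, key c ≤ key d → f c ≤ f d)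
    {p q : Q} (hlt : f p < f q) : key p < key q := by
  by_contra! h'
  exact absurd (h _ _ h') (not_le.2 hlt)

end PredState

/-- The automaton that runs the deterministic system `δ` and predicts the value of the next
return to each visited state. -/
noncomputable def predictiveAuto {A S D : Type} [Semigroup S] [Finite S] [Finite D]
    (φ : List A → S) (δ : D → A → D) (rk : D → ℕ) (d₀ : D)
    (key : PredState (GuessState D S) → ℕ) (hkey : Function.Injective key) : Auto A where
  Q := PredState (GuessState D S)
  fin := Fintype.ofFinite _
  lin := LinearOrder.lift' key hkey
  trans p a q := ∃ x ∈ p.core (guessInit d₀), match q with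
    | .init => False
    | .mid y => GuessStep φ δ rk x a y
    | .fin => ∃ y, GuessStep φ δ rk x a y ∧ GuessFinal y
  init := .init
  final := {.fin}
  rep := {q | ∃ x, q = .mid x ∧ GuessRep rk x}

section Automaton

variable {A S D : Type} [Semigroup S] [Finite S] [Finite D] {φ : List A → S} {δ : D → A → D}
  {rk : D → ℕ} {d₀ : D} (key : PredState (GuessState D S) → ℕ) (hkey : Function.Injective key)

theorem existsUnique_infAccRun (hrk : Function.Injective rk) (w : ℕ → A) :
    ∃! ρ, (predictiveAuto φ δ rk d₀ key hkey).InfAccRun w ρ := by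
  refine ⟨PredState.lift (canonicalRun φ δ rk d₀ w fun _ => True), ⟨rfl, fun i => ?_, fun n => ?_⟩,
    ?_⟩
  · exact ⟨_, PredState.core_lift _ i, guessStep_canonicalRun w _ i trivial⟩
  · obtain ⟨m, hm, h⟩ := guessRep_canonicalRun (φ := φ) (δ := δ) (rk := rk) (d₀ := d₀) w (n + 1)
    obtain ⟨m, rfl⟩ : ∃ k, m = k + 1 := ⟨m - 1, by omega⟩
    exact ⟨m + 1, by omega, _, rfl, h⟩
  · rintro ρ ⟨h0, htrans, hrep⟩
    choose x hx hstep using htrans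
    have h0' : x 0 = guessInit d₀ := by
      have := hx 0
      rw [h0] at this
      exact (Option.some.inj this).symm
    have hmid : ∀ i, ρ (i + 1) = PredState.mid (x (i + 1)) := by
      intro i
      have h1 := hx (i + 1)
      have h2 := hstep i
      cases h : ρ (i + 1) with
      | init => rw [h] at h2; exact h2.elim
      | fin => rw [h] at h1; cases h1
      | mid y => rw [h] at h1; rw [Option.some.inj h1]
    have hx' : ∀ i, x i = canonicalRun φ δ rk d₀ w (fun _ => True) i := by
      refine fun i => eq_canonicalRun hrk w _ (fun _ _ => trivial) x h0' (fun i _ => ?_)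
        (fun j _ hj => ?_) i trivial
      · have := hstep i
        rw [hmid] at this
        exact this
      · obtain ⟨m, hm, y, hy, hR⟩ := hrep (j + 1)
        have hy' : y = x m := by
          have := hx m
          rw [hy] at this
          exact Option.some.inj this
        subst hy'
        exact ⟨m, by omega, trivial, hR _ (hj m (by omega) trivial)⟩
    funext i
    cases i with
    | zero => exact h0
    | succ i => rw [hmid, hx']; rfl

theorem existsUnique_finite_run (hrk : Function.Injective rk) (w : ℕ → A) (n : ℕ) :
    ∃! ρ : Fin (n + 1 + 1) → (predictiveAuto φ δ rk d₀ key hkey).Q,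
      ρ 0 = .init ∧ (∀ i : Fin (n + 1), (predictiveAuto φ δ rk d₀ key hkey).trans
        (ρ i.castSucc) (w i) (ρ i.succ)) ∧ ρ (Fin.last (n + 1)) = .fin := by
  set dom : ℕ → Prop := fun i => i ≤ n + 1 with hdom
  refine ⟨fun i => PredState.liftFin (n + 1) (canonicalRun φ δ rk d₀ w dom) i,
    ⟨PredState.liftFin_of_ne n.succ_ne_zero.symm _, fun i => ?_, PredState.liftFin_self _ _⟩, ?_⟩
  · have hi : (i.castSucc : ℕ) ≠ n + 1 := by simpa using i.isLt.ne
    have hs := guessStep_canonicalRun (φ := φ) (δ := δ) (rk := rk) (d₀ := d₀) w dom i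
      (Nat.succ_le_of_lt i.isLt)
    refine ⟨canonicalRun φ δ rk d₀ w dom i, ?_, ?_⟩
    · beta_reduce
      rw [PredState.liftFin_of_ne hi]
      exact PredState.core_lift _ _
    · by_cases hl : (i.succ : ℕ) = n + 1
      · beta_reduce
        rw [hl, PredState.liftFin_self]
        refine ⟨_, hs, fun e p hp => guess_eq_none_of_pending w dom _ e p hp fun m h1 h2 => ?_⟩
        simp only [Fin.val_succ] at hl
        simp only [hdom] at h2
        omega
      · beta_reduce
        rw [PredState.liftFin_of_ne hl]
        exact hs
  · rintro ρ ⟨h0, htrans, hfin⟩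
    choose x hx hstep using htrans
    have hlast := hstep (Fin.last n)
    rw [Fin.succ_last, hfin] at hlast
    obtain ⟨y, hy, hacc⟩ := hlast
    have hmid : ∀ i (h : i + 1 < n + 1),
        ρ ⟨i + 1, by omega⟩ = PredState.mid (x ⟨i + 1, h⟩) := by
      intro i h
      have h1 := hx ⟨i + 1, h⟩
      have h2 := hstep ⟨i, by omega⟩
      simp only [Fin.castSucc_mk, Fin.succ_mk] at h1 h2
      cases h : ρ ⟨i + 1, by omega⟩ with
      | init => rw [h] at h2; exact h2.elim
      | fin => rw [h] at h1; cases h1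
      | mid y => rw [h] at h1; rw [Option.some.inj h1]
    have hx' : ∀ i, dom i → (if h : i < n + 1 then x ⟨i, h⟩ else y) =
        canonicalRun φ δ rk d₀ w dom i := by
      refine eq_canonicalRun hrk w dom (fun i hi => (Nat.le_succ i).trans hi) _ ?_
        (fun i hi => ?_) (fun j hj _ => ⟨n + 1, hj, le_rfl, ?_⟩)
      · have := hx 0
        rw [Fin.castSucc_zero, h0] at this
        simpa using (Option.some.inj this).symm
      · have hi' : i < n + 1 := hi
        rw [dif_pos hi']
        by_cases h : i + 1 < n + 1
        · rw [dif_pos h]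
          have := hstep ⟨i, hi'⟩
          rw [Fin.succ_mk, hmid i h] at this
          exact this
        · obtain rfl : i = n := by omega
          rw [dif_neg h]
          exact hy
      · rw [dif_neg (lt_irrefl _)]
        exact hacc _
    funext i
    obtain ⟨i, hi⟩ := i
    by_cases hl : i = n + 1
    · subst hl
      exact hfin.trans (PredState.liftFin_self _ _).symm
    · refine Eq.trans ?_ (PredState.liftFin_of_ne hl _).symm
      cases i with
      | zero => exact h0
      | succ i =>
        have h : i + 1 < n + 1 := by omega
        rw [hmid i h, PredState.lift, ← hx' _ h.le, dif_pos h]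

theorem existsUnique_finAccRun (hrk : Function.Injective rk) (w : List A) (hw : w ≠ []) :
    ∃! ρ, (predictiveAuto φ δ rk d₀ key hkey).FinAccRun w ρ := by
  have key' : ∀ n (u : Fin n → A), n ≠ 0 →
      ∃! ρ : Fin (n + 1) → (predictiveAuto φ δ rk d₀ key hkey).Q,
        ρ 0 = .init ∧ (∀ i : Fin n, (predictiveAuto φ δ rk d₀ key hkey).trans
          (ρ i.castSucc) (u i) (ρ i.succ)) ∧ ρ (Fin.last n) = .fin := by
    intro n u hn
    obtain ⟨n, rfl⟩ := Nat.exists_eq_succ_of_ne_zero hn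
    simpa using existsUnique_finite_run (φ := φ) (δ := δ) (d₀ := d₀) key hkey hrk
      (fun i => u (Fin.ofNat (n + 1) i)) n
  exact key' w.length w.get (by simpa using hw)

/-- A path returning to the inner state `z` through smaller states projects to a return in the
deterministic system, and its first segment has the predicted value. -/
theorem returnsTo_of_pathIn
    (hφ : ∀ u v : List A, u ≠ [] → v ≠ [] → φ (u ++ v) = φ u * φ v)
    (hrk : Function.Injective rk)
    (hmono : ∀ p q, key p ≤ key q → p.rank rk ≤ q.rank rk) (z : GuessState D S) :
    ∀ (v : List A) (p : PredState (GuessState D S)) (c : GuessState D S),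
      p.core (guessInit d₀) = some c →
      (predictiveAuto φ δ rk d₀ key hkey).pathIn
        ((predictiveAuto φ δ rk d₀ key hkey).below (.mid z)) p v (.mid z) →
      ReturnsTo δ rk z.1 c.1 v ∧ (∃ g, z.2 z.1 = some (g, none)) ∧
      ∀ g r, c.2 z.1 = some (g, r) → ∃ v₁ v₂, v = v₁ ++ v₂ ∧ ReturnsTo δ rk z.1 c.1 v₁ ∧
        g = some (optMul r (φ v₁)) ∧ (v₂ = [] ∨ ReturnsTo δ rk z.1 z.1 v₂) := by
  intro v
  induction v with
  | nil => exact fun _ _ _ h => h.elim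
  | cons a v ih =>
    intro p c hc hpath
    cases v with
    | nil =>
      obtain ⟨c', hc', hok, g₀, hz⟩ := hpath
      obtain rfl : c' = c := Option.some.inj (hc'.symm.trans hc)
      have hd : δ c'.1 a = z.1 := by rw [hz, guessNext]
      refine ⟨hd, ⟨g₀, ?_⟩, fun g r h => ⟨[a], [], rfl, hd, ?_, Or.inl rfl⟩⟩
      · rw [← hd, hz]
        exact guessNext_self _ _ _
      · exact (hok _ _ h).1 hd.symm
    | cons b v =>
      obtain ⟨q, hq, ⟨c', hc', htrans⟩, hpath⟩ := hpath
      obtain rfl : c' = c := Option.some.inj (hc'.symm.trans hc)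
      have hlt : key q < key (.mid z) := hq
      have hle := hmono _ _ hlt.le
      cases q with
      | init => exact htrans.elim
      | fin =>
        exact absurd (PredState.rank_lt_fin rk (q := .mid z) (by simp) (by simp)) (not_lt.2 hle)
      | mid y =>
        obtain ⟨hok, g₀, rfl⟩ := htrans
        have hle : rk (δ c'.1 a) ≤ rk z.1 := hle
        obtain ⟨h1, h2, h3⟩ := ih _ _ rfl hpath
        refine ⟨⟨hle, h1⟩, h2, fun g r h => ?_⟩
        by_cases he : δ c'.1 a = z.1
        · refine ⟨[a], b :: v, rfl, he, (hok _ _ h).1 he.symm, Or.inr ?_⟩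
          rw [← he] at h1 ⊢
          exact h1
        · have hlt : rk (δ c'.1 a) < rk z.1 := lt_of_le_of_ne hle fun h => he (hrk h)
          obtain ⟨v₁, v₂, hv, hv₁, hg, hv₂⟩ := h3 g (some (optMul r (φ [a])))
            (by rw [guessNext_of_lt _ _ _ hlt, h]; rfl)
          have hne : v₁ ≠ [] := by rintro rfl; exact hv₁
          refine ⟨a :: v₁, v₂, by rw [hv]; rfl, ?_, ?_, hv₂⟩
          · obtain ⟨b', v₁, rfl⟩ := List.exists_cons_of_ne_nil hne
            exact ⟨hle, hv₁⟩
          · rw [hg, show a :: v₁ = [a] ++ v₁ from rfl, hφ _ _ (by simp) hne, ← optMul_mul]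
            rfl

theorem not_pathIn_init {X : Set (predictiveAuto φ δ rk d₀ key hkey).Q} :
    ∀ (v : List A) (p : PredState (GuessState D S)),
      ¬ (predictiveAuto φ δ rk d₀ key hkey).pathIn X p v .init
  | [], _, h => h
  | [_], _, ⟨_, _, h⟩ => h
  | _ :: b :: v, _, ⟨_, _, _, h⟩ => not_pathIn_init (b :: v) _ h

theorem not_pathIn_fin {X : Set (predictiveAuto φ δ rk d₀ key hkey).Q}
    {q : PredState (GuessState D S)} :
    ∀ v : List A, ¬ (predictiveAuto φ δ rk d₀ key hkey).pathIn X .fin v q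
  | [], h => h
  | [_], ⟨_, h, _⟩ => by cases h
  | _ :: _ :: _, ⟨_, _, ⟨_, h, _⟩, _⟩ => by cases h

theorem predictiveAuto_G2
    (hφ : ∀ u v : List A, u ≠ [] → v ≠ [] → φ (u ++ v) = φ u * φ v)
    (hrk : Function.Injective rk)
    (hδ : ∀ d v v', ReturnsTo δ rk d d v → ReturnsTo δ rk d d v' → φ v * φ v' = φ v)
    (hmono : ∀ p q, key p ≤ key q → p.rank rk ≤ q.rank rk) :
    (predictiveAuto φ δ rk d₀ key hkey).G2 φ := by
  intro q
  have hval : ∀ v ∈ (predictiveAuto φ δ rk d₀ key hkey).Lq q, φ v * φ v = φ v ∧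
      ∀ v' ∈ (predictiveAuto φ δ rk d₀ key hkey).Lq q, φ v' = φ v := by
    cases q with
    | init => exact fun v hv => (not_pathIn_init key hkey v _ hv).elim
    | fin => exact fun v hv => (not_pathIn_fin key hkey v hv).elim
    | mid z =>
      have h : ∀ v ∈ (predictiveAuto φ δ rk d₀ key hkey).Lq (.mid z),
          ReturnsTo δ rk z.1 z.1 v ∧ z.2 z.1 = some (some (φ v), none) := by
        intro v hv
        obtain ⟨h1, ⟨g, hg⟩, h3⟩ := returnsTo_of_pathIn key hkey hφ hrk hmono z v _ z rfl hv
        obtain ⟨v₁, v₂, rfl, hv₁, hg', hv₂⟩ := h3 g none hg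
        refine ⟨h1, ?_⟩
        rw [hg, hg']
        rcases hv₂ with rfl | hv₂
        · rw [List.append_nil]
          rfl
        · rw [hφ, hδ _ _ _ hv₁ hv₂]
          · rfl
          · rintro rfl; exact hv₁
          · rintro rfl; exact hv₂
      refine fun v hv => ⟨hδ _ _ _ (h v hv).1 (h v hv).1, fun v' hv' => ?_⟩
      have := (h v' hv').2.symm.trans (h v hv).2
      simpa using this
  by_cases hne : ∃ v, v ∈ (predictiveAuto φ δ rk d₀ key hkey).Lq q
  · obtain ⟨v, hv⟩ := hne
    exact ⟨φ v, hval v hv⟩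
  · obtain ⟨e, he⟩ := exists_idempotent (φ [])
    exact ⟨e, he, fun v hv => (hne ⟨v, hv⟩).elim⟩

end Automaton

/-- **Main theorem**: for every semigroup morphism `φ : Σ⁺ → S` to a finite
semigroup there exists a `φ`-good automaton. -/
theorem exists_good_automaton {A S : Type} [Fintype A] [Semigroup S] [Fintype S]
    (φ : List A → S)
    (hφ : ∀ u v : List A, u ≠ [] → v ≠ [] → φ (u ++ v) = φ u * φ v) :
    ∃ M : Auto A, M.Good φ := by
  obtain ⟨D, hD, hD', rk, hrk, δ, hδ⟩ := exists_deterministic_split φ hφ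
  obtain ⟨d₀⟩ := hD'
  obtain ⟨key, hkey, hmono⟩ := exists_injective_refining (D := PredState (GuessState D S))
    (PredState.rank rk)
  refine ⟨predictiveAuto φ δ rk d₀ key hkey, ⟨⟨?_, ?_⟩, ?_, ?_, ?_⟩,
    PredState.fin, rfl, ?_, ?_, ?_⟩
  · exact fun w hw => existsUnique_finAccRun key hkey hrk w hw
  · exact fun w => existsUnique_infAccRun key hkey hrk w
  · exact predictiveAuto_G2 key hkey hφ hrk hδ hmono
  · rintro p a ⟨x, -, h⟩
    exact h
  · intro q hq
    exact PredState.key_lt_of_rank_lt hmono (PredState.rank_lt_init rk hq)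
  · rintro a q ⟨x, hx, -⟩
    cases hx
  · exact PredState.key_lt_of_rank_lt hmono (PredState.rank_lt_init rk (by simp))
  · intro q hq hq'
    exact PredState.key_lt_of_rank_lt hmono (PredState.rank_lt_fin rk hq hq')
end

section
/- Let φ: Σ⁺ → S be a semigroup morphism to a finite semigroup S and let c ∈ φ(Σ) be such that cS ⊊ S. Let Σ₂ = Σ ∩ φ⁻¹(c) and Σ₁ = Σ \ Σ₂, and assume Σ₁ ≠ ∅. Let B = φ(Σ₂ΣΣ₁*) ⊆ cS, viewed as a finite alphabet, and let ψ: B⁺ → cS be the evaluation morphism (ψ(b) = b for b ∈ B, extended by the product of cS). If there exist a good automaton A₁ = (Q₁,Σ₁,Δ₁,ι₁,F₁,R₁,<₁) for the restriction of φ to Σ₁⁺ and a good automaton A₂ = (Q₂,B,Δ₂,ι₂,F₂,R₂,<₂) for ψ, then there exists a φ-weakly-good automaton with state set (Q₂∪{⊥}) × (S∪{⊥}) × (Q₁∪{⊥}). -/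
/-- Product of a list of semigroup elements (`dflt` is a junk value for `[]`). -/
def evalList {S : Type} [Semigroup S] (dflt : S) : List S → S
  | [] => dflt
  | x :: l => l.foldl (· * ·) x

namespace Auto

section Runs

variable {A : Type}

/-- `M.AccOn w m N ρ`: `ρ` restricted to the positions `m, …, N` is an accepting run of `M` on the
finite or infinite factor of `w` at the positions `m ≤ i < N`. -/
structure AccOn (M : Auto A) (w : ℕ → A) (m : ℕ) (N : ℕ∞) (ρ : ℕ → M.Q) : Prop where
  start : ρ m = M.init
  step : ∀ i, m ≤ i → (i : ℕ∞) < N → M.trans (ρ i) (w i) (ρ (i + 1))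
  final : ∀ n : ℕ, N = n → ρ n ∈ M.final
  rep : N = ⊤ → ∀ n, ∃ k, n ≤ k ∧ ρ k ∈ M.rep

/-- `M` has exactly one accepting run on each nonempty finite or infinite factor whose letters
satisfy `P`. -/
def UniqueAccOn (P : A → Prop) (M : Auto A) : Prop :=
  ∀ (w : ℕ → A) (m : ℕ) (N : ℕ∞), (m : ℕ∞) < N → (∀ i, m ≤ i → (i : ℕ∞) < N → P (w i)) →
    (∃ ρ, M.AccOn w m N ρ) ∧ ∀ ρ₁ ρ₂, M.AccOn w m N ρ₁ → M.AccOn w m N ρ₂ →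
      ∀ i, m ≤ i → (i : ℕ∞) ≤ N → ρ₁ i = ρ₂ i

/-- The same automaton seen over a larger alphabet. -/
def extend {P : A → Prop} (M : Auto {a // P a}) : Auto A where
  Q := M.Q
  fin := M.fin
  lin := M.lin
  trans p a q := ∃ h : P a, M.trans p ⟨a, h⟩ q
  init := M.init
  final := M.final
  rep := M.rep

theorem finAccRun_iff (M : Auto A) (l : List A) (w : ℕ → A)
    (hw : ∀ i : Fin l.length, w i = l.get i) (ρ : ℕ → M.Q) :
    M.FinAccRun l (fun i => ρ i) ↔ M.AccOn w 0 l.length ρ := by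
  constructor
  · rintro ⟨h0, h1, h2⟩
    refine ⟨h0, fun i _ hi => ?_, fun n hn => ?_, fun h => by simp at h⟩
    · have hi' : i < l.length := by exact_mod_cast hi
      have := h1 ⟨i, hi'⟩
      rw [← hw] at this
      exact this
    · have : l.length = n := by exact_mod_cast hn
      subst this
      exact h2
  · rintro ⟨h0, h1, h2, -⟩
    refine ⟨h0, fun i => ?_, h2 _ rfl⟩
    rw [← hw]
    exact h1 i (Nat.zero_le _) (by exact_mod_cast i.2)

theorem infAccRun_iff (M : Auto A) (w : ℕ → A) (ρ : ℕ → M.Q) :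
    M.InfAccRun w ρ ↔ M.AccOn w 0 ⊤ ρ := by
  constructor
  · rintro ⟨h0, h1, h2⟩
    exact ⟨h0, fun i _ _ => h1 i, fun n hn => by simp at hn, fun _ => h2⟩
  · rintro ⟨h0, h1, -, h2⟩
    exact ⟨h0, fun i => h1 i (Nat.zero_le _) (by simp), h2 rfl⟩

theorem exists_eq_restrict {Q : Type} {n : ℕ} (r : Fin (n + 1) → Q) :
    ∃ ρ : ℕ → Q, r = fun i : Fin (n + 1) => ρ i :=
  ⟨fun i => if h : i < n + 1 then r ⟨i, h⟩ else r 0,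
    funext fun i => by beta_reduce; rw [dif_pos i.2]⟩

/-- Unique acceptance from position `0` is the same as (G1). -/
theorem G1_iff (M : Auto A) : M.G1 ↔ ∀ (w : ℕ → A) (N : ℕ∞), 0 < N →
    (∃ ρ, M.AccOn w 0 N ρ) ∧ ∀ ρ ρ', M.AccOn w 0 N ρ → M.AccOn w 0 N ρ' →
      ∀ i : ℕ, (i : ℕ∞) ≤ N → ρ i = ρ' i := by
  constructor
  · rintro ⟨hf, hi⟩ w N hN
    induction N using ENat.recTopCoe with
    | top =>
      obtain ⟨ρ, h, hu⟩ := hi w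
      refine ⟨⟨ρ, (M.infAccRun_iff w ρ).1 h⟩, fun ρ₁ ρ₂ h₁ h₂ i _ => ?_⟩
      rw [hu ρ₁ ((M.infAccRun_iff w _).2 h₁), hu ρ₂ ((M.infAccRun_iff w _).2 h₂)]
    | coe n =>
      have hn : 0 < n := by exact_mod_cast hN
      obtain ⟨l, hl, hlw⟩ : ∃ l : List A, l.length = n ∧ ∀ i : Fin l.length, w i = l.get i :=
        ⟨List.ofFn fun i : Fin n => w i, by simp, by simp⟩
      subst hl
      have hl0 : l ≠ [] := List.ne_nil_of_length_pos hn
      obtain ⟨r, h, hu⟩ := hf l hl0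
      obtain ⟨ρ, rfl⟩ := exists_eq_restrict r
      refine ⟨⟨ρ, (M.finAccRun_iff l w hlw ρ).1 h⟩, fun ρ₁ ρ₂ h₁ h₂ i hi => ?_⟩
      have e := (hu _ ((M.finAccRun_iff l w hlw _).2 h₁)).trans
        (hu _ ((M.finAccRun_iff l w hlw _).2 h₂)).symm
      have hi' : i < l.length + 1 := Nat.lt_succ_of_le (by exact_mod_cast hi)
      exact congrFun e ⟨i, hi'⟩
  · intro H
    refine ⟨fun l hl => ?_, fun w => ?_⟩
    · obtain ⟨w, hw⟩ : ∃ w : ℕ → A, ∀ i : Fin l.length, w i = l.get i :=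
        ⟨fun i => l.getD i (l.head hl), fun i => by simp⟩
      have hpos : (0 : ℕ∞) < (l.length : ℕ∞) := by exact_mod_cast List.length_pos_of_ne_nil hl
      obtain ⟨⟨ρ, h⟩, hu⟩ := H w l.length hpos
      refine ⟨fun i => ρ i, (M.finAccRun_iff l w hw ρ).2 h, fun r hr => ?_⟩
      obtain ⟨ρ', rfl⟩ := exists_eq_restrict r
      funext i
      exact hu _ _ ((M.finAccRun_iff l w hw _).1 hr) h i
        (by exact_mod_cast Nat.le_of_lt_succ i.2)
    · obtain ⟨⟨ρ, h⟩, hu⟩ := H w ⊤ (by simp)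
      refine ⟨ρ, (M.infAccRun_iff w ρ).2 h, fun ρ' h' => ?_⟩
      funext i
      exact hu _ _ ((M.infAccRun_iff w _).1 h') h i (by simp)

theorem accOn_extend_iff {P : A → Prop} (M : Auto {a // P a}) (w : ℕ → A) (m : ℕ) (N : ℕ∞)
    (w' : ℕ → {a // P a}) (hw' : ∀ i : ℕ, ((m + i : ℕ) : ℕ∞) < m + N → (w' i : A) = w (m + i))
    (ρ : ℕ → M.Q) :
    M.extend.AccOn w m (m + N) ρ ↔ M.AccOn w' 0 N (fun i => ρ (m + i)) := by
  have hlt : ∀ i : ℕ, ((m + i : ℕ) : ℕ∞) < m + N ↔ (i : ℕ∞) < N := fun i => by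
    induction N using ENat.recTopCoe with
    | top => simp
    | coe n => norm_cast; omega
  constructor
  · rintro ⟨h0, h1, h2, h3⟩
    refine ⟨h0, fun i _ hi => ?_, fun n hn => h2 (m + n) (by simp [hn]), fun hN n => ?_⟩
    · have hi' := (hlt i).2 hi
      obtain ⟨h, ht⟩ := h1 (m + i) (Nat.le_add_right _ _) hi'
      have : w' i = ⟨w (m + i), h⟩ := Subtype.ext (hw' i hi')
      rw [this]
      exact ht
    · obtain ⟨k, hk, hr⟩ := h3 (by simp [hN]) (m + n)
      refine ⟨k - m, by omega, ?_⟩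
      have e : m + (k - m) = k := by omega
      change ρ (m + (k - m)) ∈ _
      rwa [e]
  · rintro ⟨h0, h1, h2, h3⟩
    refine ⟨h0, fun i hmi hi => ?_, fun n hn => ?_, fun hN n => ?_⟩
    · obtain ⟨j, rfl⟩ := Nat.exists_eq_add_of_le hmi
      have ht := h1 j (Nat.zero_le _) ((hlt j).1 hi)
      have he := hw' j hi
      refine ⟨he ▸ (w' j).2, ?_⟩
      have : w' j = ⟨w (m + j), he ▸ (w' j).2⟩ := Subtype.ext he
      rw [this] at ht
      exact ht
    · induction N using ENat.recTopCoe with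
      | top => simp at hn
      | coe k =>
        have : n = m + k := by exact_mod_cast hn.symm
        subst this
        exact h2 k rfl
    · have hN' : N = ⊤ := by
        induction N using ENat.recTopCoe with
        | top => rfl
        | coe k => exact absurd hN (by exact_mod_cast ENat.natCast_ne_top (m + k))
      obtain ⟨k, hk, hr⟩ := h3 hN' n
      exact ⟨m + k, by omega, hr⟩

theorem uniqueAccOn_extend {P : A → Prop} (M : Auto {a // P a}) (hM : M.G1) :
    UniqueAccOn P M.extend := by
  classical
  intro w m N hmN hP
  obtain ⟨L, rfl⟩ := le_iff_exists_add.1 hmN.le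
  have hL : 0 < L := by
    rcases eq_or_ne L 0 with rfl | h
    · simp at hmN
    · exact pos_iff_ne_zero.2 h
  let w' : ℕ → {a // P a} := fun i =>
    if h : P (w (m + i)) then ⟨w (m + i), h⟩ else ⟨w m, hP m le_rfl hmN⟩
  have hw' : ∀ i : ℕ, ((m + i : ℕ) : ℕ∞) < m + L → (w' i : A) = w (m + i) := fun i hi => by
    simp [w', hP (m + i) (Nat.le_add_right _ _) hi]
  have key := accOn_extend_iff M w m L w' hw'
  obtain ⟨⟨ρ, h⟩, hu⟩ := M.G1_iff.1 hM w' L hL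
  refine ⟨⟨fun i => ρ (i - m), (key _).2 (by simpa using h)⟩, fun ρ₁ ρ₂ h₁ h₂ i hmi hi => ?_⟩
  obtain ⟨j, rfl⟩ := Nat.exists_eq_add_of_le hmi
  refine hu _ _ ((key _).1 h₁) ((key _).1 h₂) j ?_
  induction L using ENat.recTopCoe with
  | top => simp
  | coe n =>
    norm_cast at hi ⊢
    omega

end Runs

end Auto
theorem evalList_cons {S : Type} [Semigroup S] (d x : S) {l : List S} (hl : l ≠ []) :
    evalList d (x :: l) = x * evalList d l := by
  have aux : ∀ (l : List S) (x y : S), l.foldl (· * ·) (x * y) = x * l.foldl (· * ·) y := by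
    intro l
    induction l with
    | nil => intro x y; rfl
    | cons z l ih => intro x y; simp only [List.foldl_cons, mul_assoc, ih]
  cases l with
  | nil => exact absurd rfl hl
  | cons y l => exact aux l x y

namespace Auto

theorem extend_pathIn {A : Type} {P : A → Prop} (M : Auto {a // P a}) (X : Set M.Q) (q : M.Q) :
    ∀ (l : List A) (p : M.Q), M.extend.pathIn X p l q →
      ∃ l' : List {a // P a}, l = l'.map Subtype.val ∧ M.pathIn X p l' q
  | [], _, h => h.elim
  | [a], _, ⟨h, ht⟩ => ⟨[⟨a, h⟩], rfl, ht⟩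
  | a :: b :: l, _, ⟨r, hr, ⟨h, ht⟩, hp⟩ => by
    obtain ⟨l', hl, hp'⟩ := extend_pathIn M X q (b :: l) r hp
    cases l' with
    | nil => simp at hl
    | cons b' l' => exact ⟨⟨a, h⟩ :: b' :: l', by simp [hl], r, hr, ht, hp'⟩

theorem extend_G2 {A S : Type} [Semigroup S] {P : A → Prop} (M : Auto {a // P a}) (φ : List A → S)
    (h : M.G2 fun l => φ (l.map Subtype.val)) : M.extend.G2 φ := by
  intro q
  obtain ⟨e, he, hw⟩ := h q
  refine ⟨e, he, fun l hl => ?_⟩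
  obtain ⟨l', rfl, hp⟩ := extend_pathIn M _ q l q hl
  exact hw l' hp

theorem pathIn_ne_nil {A : Type} {M : Auto A} {X : Set M.Q} {p q : M.Q} {w : List A}
    (h : M.pathIn X p w q) : w ≠ [] := by
  rintro rfl
  exact h

theorem pathIn_cons {A : Type} {M : Auto A} {X : Set M.Q} {p r q : M.Q} {b : A} {l : List A}
    (hr : r ∈ X) (ht : M.trans p b r) (hl : M.pathIn X r l q) : M.pathIn X p (b :: l) q := by
  cases l with
  | nil => exact hl.elim
  | cons x l => exact ⟨r, hr, ht, hl⟩

/-- Words looping on `q` without visiting a state above `q` also evaluate to the idempotent of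
`L_q`. -/
theorem eval_loop_le {A S : Type} [Semigroup S] {φ : List A → S}
    (hφ : ∀ u v : List A, u ≠ [] → v ≠ [] → φ (u ++ v) = φ u * φ v) {M : Auto A} {q : M.Q} {e : S}
    (he : e * e = e) (hq : ∀ w ∈ M.Lq q, φ w = e) {w : List A}
    (h : M.pathIn {r | M.slt r q ∨ r = q} q w q) : φ w = e := by
  have split : ∀ (n : ℕ) (w : List A) (p : M.Q), w.length ≤ n →
      M.pathIn {r | M.slt r q ∨ r = q} p w q →
      ∃ u v, w = u ++ v ∧ M.pathIn (M.below q) p u q ∧ (v = [] ∨ (v ≠ [] ∧ φ v = e)) := by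
    intro n
    induction n with
    | zero =>
      intro w p hn hp
      exact absurd (List.length_eq_zero_iff.1 (Nat.le_zero.1 hn)) (pathIn_ne_nil hp)
    | succ n ih =>
      intro w p hn hp
      match w, hp with
      | [a], hp => exact ⟨[a], [], rfl, hp, Or.inl rfl⟩
      | a :: b :: w, ⟨r, hr, ht, hp⟩ =>
        obtain ⟨u, v, huv, hu, hv⟩ := ih (b :: w) r (by simpa using hn) hp
        rcases hr with hr | rfl
        · cases u with
          | nil => exact hu.elim
          | cons x u => exact ⟨a :: x :: u, v, by rw [huv]; rfl, ⟨r, hr, ht, hu⟩, hv⟩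
        · refine ⟨[a], b :: w, rfl, ht, Or.inr ⟨by simp, ?_⟩⟩
          rcases hv with rfl | ⟨hv0, hv⟩
          · rw [huv, List.append_nil]
            exact hq u hu
          · rw [huv, hφ u v (pathIn_ne_nil hu) hv0, hq u hu, hv, he]
  obtain ⟨u, v, rfl, hu, rfl | ⟨hv0, hv⟩⟩ := split w.length w q le_rfl h
  · rw [List.append_nil]
    exact hq u hu
  · rw [hφ u v (pathIn_ne_nil hu) hv0, hq u hu, hv, he]

section Product

variable {A S : Type}

/-- States of the product automaton. A state `(⊥, ⊥, q)` simulates the first automaton on the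
maximal beginning without a letter of value `c`; `(some p, ⊥, ⊥)` sits between two blocks;
`(τ, c, ⊥)` has just read the first letter of a block; `(τ, s, q)` has read a factor of value `s`
of the current block and simulates the first automaton on that block from its third letter on. -/
abbrev ProdState (M1 : Auto A) (M2 : Auto S) : Type := Option M2.Q × Option S × Option M1.Q

/-- The key by which product states are compared: first by the second automaton, with `⊥` on top,
then with `⊥` on top of `S`, then by the first automaton, and finally by the element of `S`. -/
noncomputable def prodKey [Fintype S] (M1 : Auto A) (M2 : Auto S) (x : ProdState M1 M2) :
    WithTop M2.Q ×ₗ Bool ×ₗ WithBot M1.Q ×ₗ WithBot (Fin (Fintype.card S)) :=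
  toLex ((x.1 : WithTop M2.Q), toLex (x.2.1.isNone, toLex ((x.2.2 : WithBot M1.Q),
    (x.2.1.map (Fintype.equivFin S) : WithBot (Fin (Fintype.card S))))))

theorem lt_of_toLex_lt {α β : Type} [Preorder α] [LT β] {a : α} {b b' : β}
    (h : toLex (a, b) < toLex (a, b')) : b < b' := by
  rcases Prod.Lex.toLex_lt_toLex.1 h with h | h
  · exact absurd h (lt_irrefl a)
  · exact h.2

theorem prodKey_injective [Fintype S] (M1 : Auto A) (M2 : Auto S) :
    Function.Injective (prodKey M1 M2) := by
  rintro ⟨x, y, z⟩ ⟨x', y', z'⟩ h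
  have h1 := congrArg Prod.fst h
  have h2 := congrArg (fun k => k.2.2.1) h
  have h3 := congrArg (fun k => k.2.2.2) h
  have h4 := Option.map_injective (Fintype.equivFin S).injective h3
  have hx : x = x' := h1
  have hz : z = z' := h2
  have hy : y = y' := h4
  rw [hx, hz, hy]

/-- The lexicographic order on product states given by `prodKey`. -/
noncomputable abbrev prodOrder [Fintype S] (M1 : Auto A) (M2 : Auto S) :
    LinearOrder (ProdState M1 M2) :=
  letI := M1.lin
  letI := M2.lin
  LinearOrder.lift' (prodKey M1 M2) (prodKey_injective M1 M2)

variable [Semigroup S]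

/-- Transitions of the product automaton. -/
inductive ProdTrans (φ : List A → S) (c : S) (M1 : Auto A) (M2 : Auto S) (f1 : M1.Q) :
    ProdState M1 M2 → A → ProdState M1 M2 → Prop
  | pre_pre {q a q'} : M1.trans q a q' →
      ProdTrans φ c M1 M2 f1 (none, none, some q) a (none, none, some q')
  | pre_lone {q a τ} : φ [a] = c → (q = M1.init ∨ q = f1) → (τ = none ∨ τ = some M2.init) →
      ProdTrans φ c M1 M2 f1 (none, none, some q) a (τ, some c, none)
  | bd_lone {p a} : φ [a] = c →
      ProdTrans φ c M1 M2 f1 (some p, none, none) a (some p, some c, none)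
  | lone_blk {τ a} :
      ProdTrans φ c M1 M2 f1 (τ, some c, none) a (τ, some (c * φ [a]), some M1.init)
  | lone_bd {p a p'} : M2.trans p (c * φ [a]) p' →
      ProdTrans φ c M1 M2 f1 (some p, some c, none) a (some p', none, none)
  | blk_blk {τ s q a q'} : M1.trans q a q' →
      ProdTrans φ c M1 M2 f1 (τ, some s, some q) a (τ, some (s * φ [a]), some q')
  | blk_bd {p s q a p'} : M1.trans q a f1 → M2.trans p (s * φ [a]) p' →
      ProdTrans φ c M1 M2 f1 (some p, some s, some q) a (some p', none, none)

variable {φ : List A → S} {c : S} {M1 : Auto A} {M2 : Auto S} {f1 : M1.Q} {f2 : M2.Q}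

theorem prodTrans_bd_letter {p : M2.Q} {a : A} {y : ProdState M1 M2}
    (h : ProdTrans φ c M1 M2 f1 (some p, none, none) a y) :
    φ [a] = c ∧ y = (some p, some c, none) := by
  cases h with
  | bd_lone h => exact ⟨h, rfl⟩

theorem prodTrans_pre {q : M1.Q} {a : A} {y : ProdState M1 M2}
    (h : ProdTrans φ c M1 M2 f1 (none, none, some q) a y) :
    (∃ q', M1.trans q a q' ∧ y = (none, none, some q')) ∨
      φ [a] = c ∧ (q = M1.init ∨ q = f1) ∧
        ∃ τ, (τ = none ∨ τ = some M2.init) ∧ y = (τ, some c, none) := by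
  cases h with
  | pre_pre h => exact Or.inl ⟨_, h, rfl⟩
  | pre_lone h h' h'' => exact Or.inr ⟨h, h', _, h'', rfl⟩

theorem prodTrans_lone {τ : Option M2.Q} {s : S} {a : A} {y : ProdState M1 M2}
    (h : ProdTrans φ c M1 M2 f1 (τ, some s, none) a y) :
    y = (τ, some (s * φ [a]), some M1.init) ∨
      ∃ p p', τ = some p ∧ M2.trans p (s * φ [a]) p' ∧ y = (some p', none, none) := by
  cases h with
  | lone_blk => exact Or.inl rfl
  | lone_bd h => exact Or.inr ⟨_, _, rfl, h, rfl⟩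

theorem prodTrans_blk {τ : Option M2.Q} {s : S} {q : M1.Q} {a : A} {y : ProdState M1 M2}
    (h : ProdTrans φ c M1 M2 f1 (τ, some s, some q) a y) :
    (∃ q', M1.trans q a q' ∧ y = (τ, some (s * φ [a]), some q')) ∨
      ∃ p p', τ = some p ∧ M1.trans q a f1 ∧ M2.trans p (s * φ [a]) p' ∧
        y = (some p', none, none) := by
  cases h with
  | blk_blk h => exact Or.inl ⟨_, h, rfl⟩
  | blk_bd h₁ h₂ => exact Or.inr ⟨_, _, rfl, h₁, h₂, rfl⟩

/-- Value of the factor of `w` at the positions `t, …, t + 1 + j`, when the letter at `t` has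
value `c`. -/
def blockValue (φ : List A → S) (c : S) (w : ℕ → A) (t : ℕ) : ℕ → S
  | 0 => c * φ [w (t + 1)]
  | j + 1 => blockValue φ c w t j * φ [w (t + 2 + j)]

theorem exists_blockValue (hφ : ∀ u v : List A, u ≠ [] → v ≠ [] → φ (u ++ v) = φ u * φ v)
    {w : ℕ → A} {t : ℕ} (hc : φ [w t] = c) (j : ℕ)
    (hl : ∀ i, t + 2 ≤ i → i < t + 2 + j → φ [w i] ≠ c) :
    ∃ u : List A, (∀ y ∈ u, φ [y] ≠ c) ∧ φ (w t :: w (t + 1) :: u) = blockValue φ c w t j := by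
  induction j with
  | zero =>
    refine ⟨[], by simp, ?_⟩
    rw [blockValue, ← hc, ← hφ _ _ (by simp) (by simp)]
    rfl
  | succ j ih =>
    obtain ⟨u, hu, he⟩ := ih fun i hi hi' => hl i hi (by omega)
    refine ⟨u ++ [w (t + 2 + j)], fun y hy => ?_, ?_⟩
    · rcases List.mem_append.1 hy with hy | hy
      · exact hu y hy
      · rw [List.mem_singleton.1 hy]
        exact hl _ (by omega) (by omega)
    · rw [blockValue, ← he, ← hφ _ _ (by simp) (by simp)]
      rfl

/-- What the product construction needs to know about its two components. -/
structure ProdInput (φ : List A → S) (c : S) (M1 : Auto A) (M2 : Auto S) (f1 : M1.Q)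
    (f2 : M2.Q) : Prop where
  letter : ∀ q a q', M1.trans q a q' → φ [a] ≠ c
  init_in : ∀ q a, ¬ M1.trans q a M1.init
  final₁ : M1.final = {f1}
  unique₁ : M1.UniqueAccOn fun a => φ [a] ≠ c
  final₂ : M2.final = {f2}
  out₂ : ∀ s p, ¬ M2.trans f2 s p
  ne₂ : f2 ≠ M2.init
  unique₂ : M2.UniqueAccOn fun s => ∃ (b a : A) (u : List A), φ [b] = c ∧ (∀ y ∈ u, φ [y] ≠ c) ∧
    φ (b :: a :: u) = s

theorem coe_succ_le {i : ℕ} {N : ℕ∞} : ((i + 1 : ℕ) : ℕ∞) ≤ N ↔ (i : ℕ∞) < N := by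
  induction N using ENat.recTopCoe with
  | top => simp
  | coe n => norm_cast

theorem coe_lt_of_le {i j : ℕ} {N : ℕ∞} (hij : i ≤ j) (h : (j : ℕ∞) < N) : (i : ℕ∞) < N :=
  lt_of_le_of_lt (Nat.cast_le.2 hij) h

/-- An accepting run of the first automaton on a block, from its third letter on, gives a run of
the product on this block. -/
theorem ProdInput.exists_block_run (H : ProdInput φ c M1 M2 f1 f2) {w : ℕ → A} {t : ℕ} {E : ℕ∞}
    {τ : Option M2.Q} {x y : ProdState M1 M2} (htE : ((t + 2 : ℕ) : ℕ∞) ≤ E)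
    (hx : ProdTrans φ c M1 M2 f1 x (w t) (τ, some c, none))
    (hletter : ∀ i : ℕ, t + 2 ≤ i → (i : ℕ∞) < E → φ [w i] ≠ c)
    (hy : ∀ n : ℕ, E = n → ∃ p p', τ = some p ∧ y = (some p', none, none) ∧
      M2.trans p (blockValue φ c w t (n - (t + 2))) p') :
    ∃ ρ : ℕ → ProdState M1 M2, ρ t = x ∧
      (∀ i : ℕ, t ≤ i → (i : ℕ∞) < E → ProdTrans φ c M1 M2 f1 (ρ i) (w i) (ρ (i + 1))) ∧
      (∀ n : ℕ, E = n → ρ n = y) ∧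
      (E = ⊤ → ∀ n, ∃ k, n ≤ k ∧ ∃ s, ∃ q ∈ M1.rep, ρ k = (τ, some s, some q)) := by
  classical
  obtain ⟨q, hq⟩ : ∃ q : ℕ → M1.Q, ((t + 2 : ℕ) : ℕ∞) < E → M1.AccOn w (t + 2) E q := by
    by_cases h : ((t + 2 : ℕ) : ℕ∞) < E
    · obtain ⟨q, hq⟩ := (H.unique₁ w (t + 2) E h hletter).1
      exact ⟨q, fun _ => hq⟩
    · exact ⟨fun _ => M1.init, fun h' => absurd h' h⟩
  let ρ : ℕ → ProdState M1 M2 := fun i =>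
    if i ≤ t then x else if i = t + 1 then (τ, some c, none) else
      if (i : ℕ∞) < E then (τ, some (blockValue φ c w t (i - (t + 2))), some (q i)) else y
  have h0 : ρ t = x := if_pos le_rfl
  have h1 : ρ (t + 1) = (τ, some c, none) := by simp [ρ]
  have h2 : ∀ j : ℕ, ((t + 2 + j : ℕ) : ℕ∞) < E →
      ρ (t + 2 + j) = (τ, some (blockValue φ c w t j), some (q (t + 2 + j))) := by
    intro j hj
    simp only [ρ, if_neg (show ¬ t + 2 + j ≤ t by omega),
      if_neg (show ¬ t + 2 + j = t + 1 by omega), if_pos hj, Nat.add_sub_cancel_left]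
  have h3 : ∀ n : ℕ, E = n → ρ n = y := by
    rintro n rfl
    have hn : t + 2 ≤ n := by exact_mod_cast htE
    simp only [ρ, if_neg (show ¬ n ≤ t by omega), if_neg (show ¬ n = t + 1 by omega),
      if_neg (lt_irrefl _)]
  refine ⟨ρ, h0, fun i hi hiE => ?_, h3, ?_⟩
  · rcases (show i = t ∨ i = t + 1 ∨ t + 2 ≤ i by omega) with rfl | rfl | hi
    · rw [h0, h1]
      exact hx
    · rw [h1]
      by_cases hs : ((t + 2 : ℕ) : ℕ∞) < E
      · have := h2 0 hs
        rw [show t + 1 + 1 = t + 2 + 0 from rfl, this, Nat.add_zero, (hq hs).start]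
        exact ProdTrans.lone_blk
      · have hE : E = ((t + 2 : ℕ) : ℕ∞) := le_antisymm (not_lt.1 hs) htE
        obtain ⟨p, p', rfl, hy, ht⟩ := hy _ hE
        rw [show t + 1 + 1 = t + 2 from rfl, h3 _ hE, hy]
        rw [Nat.sub_self] at ht
        exact ProdTrans.lone_bd ht
    · have hs := coe_lt_of_le hi hiE
      obtain ⟨j, rfl⟩ := Nat.exists_eq_add_of_le hi
      have ht := (hq hs).step _ hi hiE
      rw [h2 j hiE]
      by_cases hs' : ((t + 2 + j + 1 : ℕ) : ℕ∞) < E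
      · have := h2 (j + 1) hs'
        rw [show t + 2 + j + 1 = t + 2 + (j + 1) from rfl, this]
        exact ProdTrans.blk_blk ht
      · have hE : E = ((t + 2 + j + 1 : ℕ) : ℕ∞) := le_antisymm (not_lt.1 hs') (coe_succ_le.2 hiE)
        obtain ⟨p, p', rfl, hy, ht'⟩ := hy _ hE
        rw [h3 _ hE, hy]
        rw [show t + 2 + j + 1 - (t + 2) = j + 1 by omega] at ht'
        have hf := (hq hs).final _ hE
        rw [H.final₁, Set.mem_singleton_iff] at hf
        rw [hf] at ht
        exact ProdTrans.blk_bd ht ht'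
  · rintro rfl n
    obtain ⟨k, hk, hr⟩ := (hq (ENat.natCast_lt_top _)).rep rfl (n + (t + 2))
    obtain ⟨j, rfl⟩ := Nat.exists_eq_add_of_le (show t + 2 ≤ k by omega)
    exact ⟨_, by omega, _, _, hr, h2 j (ENat.natCast_lt_top _)⟩

/-- `T` lists the starting positions of the blocks of the word `w` of length `N`: block `k`
occupies the positions from `T k` to `T (k + 1)`, for `k < K`, and consists of a letter satisfying
`P`, an arbitrary letter, and letters not satisfying `P`. -/
structure BlockCut (P : A → Prop) (w : ℕ → A) (N : ℕ∞) (T : ℕ → ℕ) (K : ℕ∞) : Prop where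
  mono : StrictMono T
  before : ∀ i < T 0, ¬ P (w i)
  first_le : (T 0 : ℕ∞) ≤ N
  block : ∀ k : ℕ, (k : ℕ∞) < K → P (w (T k)) ∧ T k + 2 ≤ T (k + 1) ∧ (T (k + 1) : ℕ∞) ≤ N ∧
    ∀ i, T k + 2 ≤ i → i < T (k + 1) → ¬ P (w i)
  tail : ∀ k : ℕ, K = k → N = T k ∨
    P (w (T k)) ∧ (N = (T k + 1 : ℕ) ∨ N = ⊤ ∧ ∀ i, T k + 2 ≤ i → ¬ P (w i))

theorem exists_blockCut (P : A → Prop) (w : ℕ → A) (N : ℕ∞) :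
    (N = ⊤ ∧ ∀ i, ¬ P (w i)) ∨ ∃ T K, BlockCut P w N T K := by
  classical
  let C : ℕ → ℕ → Prop := fun t m => t ≤ m ∧ (m : ℕ∞) ≤ N ∧ (N = m ∨ P (w m))
  have hC : ∀ t m : ℕ, t ≤ m → (m : ℕ∞) ≤ N → (∀ l, l < m → ¬ C t l) → ∀ i : ℕ, t ≤ i → i < m →
      ¬ P (w i) := fun t m htm hm hl i hi hi' hP =>
    hl i hi' ⟨hi, le_trans (Nat.cast_le.2 hi'.le) hm, Or.inr hP⟩
  have hnC : ∀ t : ℕ, (¬ ∃ m, C t m) → N < t ∨ N = ⊤ ∧ ∀ i : ℕ, t ≤ i → ¬ P (w i) := by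
    intro t h
    by_cases hN : N = ⊤
    · exact Or.inr ⟨hN, fun i hi hP => h ⟨i, hi, by simp [hN], Or.inr hP⟩⟩
    · obtain ⟨n, rfl⟩ := ENat.ne_top_iff_exists.1 hN
      left
      by_contra hlt
      exact h ⟨n, by exact_mod_cast not_lt.1 hlt, le_rfl, Or.inl rfl⟩
  by_cases h0 : ∃ m, C 0 m
  swap
  · rcases hnC 0 h0 with h | ⟨h, h'⟩
    · simp at h
    · exact Or.inl ⟨h, fun i => h' i (Nat.zero_le _)⟩
  right
  let next : ℕ → ℕ := fun t => if h : ∃ m, C (t + 2) m then Nat.find h else t + 1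
  obtain ⟨T, hT0, hT⟩ : ∃ T : ℕ → ℕ, T 0 = Nat.find h0 ∧ ∀ k, T (k + 1) = next (T k) :=
    ⟨fun k => Nat.rec (Nat.find h0) (fun _ t => next t) k, rfl, fun _ => rfl⟩
  have hnext : ∀ t, t < next t := by
    intro t
    simp only [next]
    split_ifs with h
    · exact lt_of_lt_of_le (by omega) (Nat.find_spec h).1
    · omega
  have hfind : ∀ k, ∀ h : ∃ m, C (T k + 2) m, T (k + 1) = Nat.find h := fun k h =>
    (hT k).trans (dif_pos h)
  obtain ⟨K, hK, hK'⟩ : ∃ K : ℕ∞, (∀ k : ℕ, (k : ℕ∞) < K → ∃ m, C (T k + 2) m) ∧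
      ∀ k : ℕ, K = k → ¬ ∃ m, C (T k + 2) m := by
    by_cases h : ∃ k, ¬ ∃ m, C (T k + 2) m
    · refine ⟨Nat.find h, fun k hk => ?_, fun k hk => ?_⟩
      · exact not_not.1 (Nat.find_min h (by exact_mod_cast hk))
      · rw [← (Nat.cast_inj.1 hk : Nat.find h = k)]
        exact Nat.find_spec h
    · refine ⟨⊤, fun k _ => not_not.1 fun h' => h ⟨k, h'⟩, fun k hk => by simp at hk⟩
  have hgood : ∀ k : ℕ, (k : ℕ∞) ≤ K → (T k : ℕ∞) ≤ N ∧ (N = T k ∨ P (w (T k))) := by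
    intro k hk
    cases k with
    | zero => exact hT0 ▸ (Nat.find_spec h0).2
    | succ k =>
      have h := hK k (coe_succ_le.1 hk)
      rw [hfind k h]
      exact (Nat.find_spec h).2
  refine ⟨T, K, strictMono_nat_of_lt_succ fun k => hT k ▸ hnext (T k), ?_,
    (hgood 0 (by simp)).1, ?_, ?_⟩
  · exact fun i hi => hC 0 (T 0) (Nat.zero_le _) (hgood 0 (by simp)).1
      (fun l hl => Nat.find_min h0 (hT0 ▸ hl)) i (Nat.zero_le _) hi
  · intro k hk
    have h := hK k hk
    have hf := hfind k h
    have hs := Nat.find_spec h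
    have h1 : (T (k + 1) : ℕ∞) ≤ N := hf ▸ hs.2.1
    have h2 : T k + 2 ≤ T (k + 1) := hf ▸ hs.1
    refine ⟨(hgood k hk.le).2.resolve_left fun hN => ?_, h2, h1, ?_⟩
    · rw [hN] at h1
      have : T (k + 1) ≤ T k := by exact_mod_cast h1
      omega
    · exact hC _ _ h2 h1 fun l hl => Nat.find_min h (hf ▸ hl)
  · intro k hk
    obtain ⟨hle, hN⟩ := hgood k hk.ge
    rcases hN with hN | hP
    · exact Or.inl hN
    · rcases hnC _ (hK' k hk) with h | h
      · obtain ⟨n, rfl⟩ := ENat.ne_top_iff_exists.1 h.ne_top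
        have h' : n < T k + 2 := by exact_mod_cast h
        have h'' : T k ≤ n := by exact_mod_cast hle
        rcases (show n = T k ∨ n = T k + 1 by omega) with rfl | rfl
        · exact Or.inl rfl
        · exact Or.inr ⟨hP, Or.inl rfl⟩
      · exact Or.inr ⟨hP, Or.inr h⟩

section BlockCut

variable {P : A → Prop} {w : ℕ → A} {N K : ℕ∞} {T : ℕ → ℕ}

theorem BlockCut.le (h : BlockCut P w N T K) {k : ℕ} (hk : (k : ℕ∞) ≤ K) : (T k : ℕ∞) ≤ N := by
  cases k with
  | zero => exact h.first_le
  | succ k => exact (h.block k (coe_succ_le.1 hk)).2.2.1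

theorem BlockCut.letter (h : BlockCut P w N T K) {k : ℕ} (hk : (k : ℕ∞) ≤ K)
    (hN : (T k : ℕ∞) < N) : P (w (T k)) := by
  rcases hk.lt_or_eq with hk | hk
  · exact (h.block k hk).1
  · rcases h.tail k hk.symm with h | h
    · exact absurd h hN.ne'
    · exact h.1

theorem BlockCut.eq_top (h : BlockCut P w N T ⊤) : N = ⊤ := by
  refine ENat.eq_top_iff_forall_ge.2 fun n => ?_
  exact le_trans (Nat.cast_le.2 h.mono.le_apply) (h.le le_top)

theorem exists_between (hT : StrictMono T) {i : ℕ} (hi : T 0 ≤ i) :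
    ∃ k, T k ≤ i ∧ i < T (k + 1) := by
  have h : ∃ k, i < T k := ⟨i + 1, hT.le_apply (x := i + 1)⟩
  classical
  have hs := Nat.find_spec h
  have hm := fun k => Nat.find_min h (m := k)
  rcases hk : Nat.find h with _ | k
  · rw [hk] at hs
    omega
  · rw [hk] at hs hm
    exact ⟨k, not_lt.1 (hm k (by omega)), hs⟩

/-- Runs on consecutive intervals that agree on the common end points fit together. -/
theorem exists_glue {Q : Type} (hT : StrictMono T) (R : ℕ → ℕ → Q)
    (hR : ∀ k, R k (T (k + 1)) = R (k + 1) (T (k + 1))) (pre : ℕ → Q)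
    (hpre : pre (T 0) = R 0 (T 0)) :
    ∃ ρ : ℕ → Q, (∀ i ≤ T 0, ρ i = pre i) ∧
      ∀ k i, T k ≤ i → i ≤ T (k + 1) → ρ i = R k i := by
  classical
  let ρ : ℕ → Q := fun i =>
    if h : T 0 ≤ i then R (exists_between hT h).choose i else pre i
  have hρ : ∀ k i, T k ≤ i → i < T (k + 1) → ρ i = R k i := by
    intro k i hk hk'
    have h : T 0 ≤ i := (hT.monotone (Nat.zero_le k)).trans hk
    obtain ⟨h1, h2⟩ := (exists_between hT h).choose_spec
    have : (exists_between hT h).choose = k := by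
      have a1 := hT.lt_iff_lt.1 (h1.trans_lt hk')
      have a2 := hT.lt_iff_lt.1 (hk.trans_lt h2)
      omega
    simp only [ρ, dif_pos h, this]
  refine ⟨ρ, fun i hi => ?_, fun k i hk hk' => ?_⟩
  · rcases hi.lt_or_eq with hi | rfl
    · simp only [ρ, dif_neg (not_le.2 hi)]
    · rw [hpre, hρ 0 _ le_rfl (hT (Nat.lt_succ_self 0))]
  · rcases hk'.lt_or_eq with hk' | rfl
    · exact hρ k i hk hk'
    · rw [hρ (k + 1) _ le_rfl (hT (Nat.lt_succ_self _)), hR]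

end BlockCut

theorem BlockCut.exists_blockValue
    (hφ : ∀ u v : List A, u ≠ [] → v ≠ [] → φ (u ++ v) = φ u * φ v) {w : ℕ → A} {N K : ℕ∞}
    {T : ℕ → ℕ} (h : BlockCut (fun a => φ [a] = c) w N T K) (k : ℕ) (hk : (k : ℕ∞) < K) :
    ∃ (b a : A) (u : List A), φ [b] = c ∧ (∀ y ∈ u, φ [y] ≠ c) ∧
      φ (b :: a :: u) = blockValue φ c w (T k) (T (k + 1) - (T k + 2)) := by
  obtain ⟨h1, h2, -, h4⟩ := h.block k hk
  obtain ⟨u, hu, he⟩ := Auto.exists_blockValue hφ h1 (T (k + 1) - (T k + 2))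
    fun i hi hi' => h4 i hi (by omega)
  exact ⟨_, _, u, h1, hu, he⟩

/-- The product automaton. -/
noncomputable abbrev prod [Fintype S] (φ : List A → S) (c : S) (M1 : Auto A) (M2 : Auto S)
    (f1 : M1.Q) (f2 : M2.Q) : Auto A where
  Q := ProdState M1 M2
  fin :=
    letI := M1.fin
    letI := M2.fin
    inferInstance
  lin := prodOrder M1 M2
  trans := ProdTrans φ c M1 M2 f1
  init := (none, none, some M1.init)
  final := {x | x = (none, none, some f1) ∨ x = (some f2, none, none) ∨ x = (none, some c, none) ∨
    x = (some f2, some c, none)}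
  rep := {x | (∃ q ∈ M1.rep, x = (none, none, some q)) ∨
    (∃ p ∈ M2.rep, x = (some p, none, none)) ∨
    ∃ τ s, ∃ q ∈ M1.rep, (τ = none ∨ τ = some f2) ∧ x = (τ, some s, some q)}

variable [Fintype S]

theorem prod_slt_init (hinit : ∀ q, q ≠ M1.init → M1.slt q M1.init) (x : ProdState M1 M2)
    (hx : x ≠ (none, none, some M1.init)) :
    (prod φ c M1 M2 f1 f2).slt x (none, none, some M1.init) := by
  let := M1.lin
  let := M2.lin
  change prodKey M1 M2 x < prodKey M1 M2 _
  obtain ⟨τ, s, q⟩ := x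
  simp only [prodKey, Prod.Lex.toLex_lt_toLex]
  rcases τ with _ | p
  · right
    refine ⟨rfl, ?_⟩
    rcases s with _ | s
    · right
      refine ⟨rfl, Or.inl ?_⟩
      rcases q with _ | q
      · exact WithBot.bot_lt_coe _
      · exact WithBot.coe_lt_coe.2 (hinit q (by rintro rfl; exact hx rfl))
    · left
      simp
  · left
    exact WithTop.coe_lt_top _

theorem prod_slt_pre {q q' : M1.Q}
    (h : ((none, none, some q') : ProdState M1 M2) ∈
      (prod φ c M1 M2 f1 f2).below (none, none, some q)) :
    M1.slt q' q := by
  let := M1.lin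
  let := M2.lin
  change prodKey M1 M2 _ < prodKey M1 M2 _ at h
  rcases Prod.Lex.toLex_lt_toLex.1 (lt_of_toLex_lt (lt_of_toLex_lt h)) with h | h
  · exact WithBot.coe_lt_coe.1 h
  · exact absurd h.2 (lt_irrefl _)

theorem prod_slt_bd {p p' : M2.Q}
    (h : ((some p', none, none) : ProdState M1 M2) ∈
      (prod φ c M1 M2 f1 f2).below (some p, none, none)) :
    M2.slt p' p := by
  let := M1.lin
  let := M2.lin
  change prodKey M1 M2 _ < prodKey M1 M2 _ at h
  rcases Prod.Lex.toLex_lt_toLex.1 h with h | h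
  · exact WithTop.coe_lt_coe.1 h
  · exact absurd h.2 (lt_irrefl _)

theorem prod_not_slt_bd {p : M2.Q} {s : S} {z : Option M1.Q} :
    ¬ ((some p, none, none) : ProdState M1 M2) ∈
      (prod φ c M1 M2 f1 f2).below (some p, some s, z) := by
  let := M1.lin
  let := M2.lin
  intro h
  change prodKey M1 M2 _ < prodKey M1 M2 _ at h
  rcases Prod.Lex.toLex_lt_toLex.1 (lt_of_toLex_lt h) with h | h
  · exact absurd (show true < false from h) (by decide)
  · exact absurd (show true = false from h.1) (by decide)

theorem prod_slt_blk {τ : Option M2.Q} {s s' : S} {q q' : M1.Q}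
    (h : ((τ, some s', some q') : ProdState M1 M2) ∈
      (prod φ c M1 M2 f1 f2).below (τ, some s, some q)) :
    M1.slt q' q ∨ q' = q := by
  let := M1.lin
  let := M2.lin
  change prodKey M1 M2 _ < prodKey M1 M2 _ at h
  rcases Prod.Lex.toLex_lt_toLex.1 (lt_of_toLex_lt (lt_of_toLex_lt h)) with h | h
  · exact Or.inl (WithBot.coe_lt_coe.1 h)
  · exact Or.inr (WithBot.coe_inj.1 h.1)

theorem prod_G3 (hinit : ∀ q, q ≠ M1.init → M1.slt q M1.init)
    (hin : ∀ p a, ¬ M1.trans p a M1.init) : (prod φ c M1 M2 f1 f2).G3 := by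
  refine ⟨fun p a h => ?_, fun x hx => prod_slt_init hinit x hx⟩
  change ProdTrans φ c M1 M2 f1 p a (none, none, some M1.init) at h
  cases h with
  | pre_pre h => exact hin _ _ h

theorem not_pathIn_of_invariant {M : Auto A} {X Z : Set M.Q} {y : M.Q}
    (hZ : ∀ x ∈ Z, ∀ a x', M.trans x a x' → x' ≠ y ∧ (x' ∈ X → x' ∈ Z)) :
    ∀ (w : List A), ∀ x ∈ Z, ¬ M.pathIn X x w y
  | [], _, _, h => h
  | [a], x, hx, h => (hZ x hx a y h).1 rfl
  | a :: b :: w, x, hx, ⟨r, hr, ht, hp⟩ =>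
    not_pathIn_of_invariant hZ (b :: w) r ((hZ x hx a r ht).2 hr) hp

theorem prod_pathIn_pre {q : M1.Q} : ∀ (w : List A) (q₀ : M1.Q),
    (prod φ c M1 M2 f1 f2).pathIn ((prod φ c M1 M2 f1 f2).below (none, none, some q))
      (none, none, some q₀) w (none, none, some q) →
    M1.pathIn {r | M1.slt r q ∨ r = q} q₀ w q
  | [], _, h => h.elim
  | [a], _, h => by
    change ProdTrans φ c M1 M2 f1 _ a _ at h
    cases h with
    | pre_pre h => exact h
  | a :: b :: w, q₀, ⟨r, hr, ht, hp⟩ => by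
    change ProdTrans φ c M1 M2 f1 _ a _ at ht
    cases ht with
    | pre_pre h => exact ⟨_, Or.inl (prod_slt_pre hr), h, prod_pathIn_pre _ _ hp⟩
    | pre_lone =>
      refine absurd hp (not_pathIn_of_invariant
        (Z := {x : ProdState M1 M2 | ∀ q : M1.Q, x ≠ ((none, none, some q) : ProdState M1 M2)})
        ?_ _ _ ?_)
      · intro x hx a x' h
        change ProdTrans φ c M1 M2 f1 x a x' at h
        cases h with
        | pre_pre => exact absurd rfl (hx _)
        | pre_lone => exact absurd rfl (hx _)
        | _ => simp
      · simp

theorem prod_pathIn_blk {τ : Option M2.Q} {s : S} {q : M1.Q} : ∀ (w : List A) (s₀ : S) (q₀ : M1.Q),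
    (prod φ c M1 M2 f1 f2).pathIn ((prod φ c M1 M2 f1 f2).below (τ, some s, some q))
      (τ, some s₀, some q₀) w (τ, some s, some q) →
    M1.pathIn {r | M1.slt r q ∨ r = q} q₀ w q
  | [], _, _, h => h.elim
  | [a], _, _, h => by
    change ProdTrans φ c M1 M2 f1 _ a _ at h
    cases h with
    | blk_blk h => exact h
  | a :: b :: w, s₀, q₀, ⟨r, hr, ht, hp⟩ => by
    change ProdTrans φ c M1 M2 f1 _ a _ at ht
    cases ht with
    | blk_blk h => exact ⟨_, prod_slt_blk hr, h, prod_pathIn_blk _ _ _ hp⟩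
    | blk_bd h h' =>
      rename_i p p'
      refine absurd hp (not_pathIn_of_invariant
        (Z := {x : ProdState M1 M2 | (∀ q : M1.Q, x ≠ ((none, none, some q) : ProdState M1 M2)) ∧
          x.1 ≠ some p})
        ?_ _ _ ?_)
      · rintro x ⟨hx, hxp⟩ a x' h
        change ProdTrans φ c M1 M2 f1 x a x' at h
        have not_bd : ∀ p' : M2.Q, ((some p', none, none) : ProdState M1 M2) ∈
            (prod φ c M1 M2 f1 f2).below (some p, some s, some q) → p' ≠ p := by
          rintro p' hp' rfl
          exact prod_not_slt_bd hp'
        cases h with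
        | pre_pre => exact absurd rfl (hx _)
        | pre_lone => exact absurd rfl (hx _)
        | lone_bd => exact ⟨by simp, fun h => ⟨by simp, by simpa using not_bd _ h⟩⟩
        | blk_bd => exact ⟨by simp, fun h => ⟨by simp, by simpa using not_bd _ h⟩⟩
        | bd_lone => exact ⟨by simp, fun _ => ⟨by simp, hxp⟩⟩
        | lone_blk => exact ⟨fun h => hxp (congrArg Prod.fst h), fun _ => ⟨by simp, hxp⟩⟩
        | blk_blk => exact ⟨fun h => hxp (congrArg Prod.fst h), fun _ => ⟨by simp, hxp⟩⟩
      · refine ⟨by simp, ?_⟩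
        rintro h
        have h : p' = p := Option.some.inj h
        subst h
        exact prod_not_slt_bd hr

theorem prod_not_pathIn_lone {τ : Option M2.Q} {s : S} (w : List A) :
    ¬ (prod φ c M1 M2 f1 f2).pathIn ((prod φ c M1 M2 f1 f2).below (τ, some s, none))
      (τ, some s, none) w (τ, some s, none) := by
  refine not_pathIn_of_invariant
    (Z := {x : ProdState M1 M2 | (∀ q : M1.Q, x ≠ ((none, none, some q) : ProdState M1 M2)) ∧
      ∀ p : M2.Q, τ = some p → x ≠ ((some p, none, none) : ProdState M1 M2)}) ?_ w _ ?_
  · rintro x ⟨hx, hxp⟩ a x' h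
    change ProdTrans φ c M1 M2 f1 x a x' at h
    have not_bd : ∀ p' : M2.Q, ((some p', none, none) : ProdState M1 M2) ∈
        (prod φ c M1 M2 f1 f2).below (τ, some s, none) →
        ∀ p, τ = some p → ((some p', none, none) : ProdState M1 M2) ≠ (some p, none, none) := by
      rintro p' hp' p rfl h
      have h : p' = p := Option.some.inj (congrArg Prod.fst h)
      subst h
      exact prod_not_slt_bd hp'
    cases h with
    | pre_pre => exact absurd rfl (hx _)
    | pre_lone => exact absurd rfl (hx _)
    | lone_bd => exact ⟨by simp, fun h => ⟨by simp, not_bd _ h⟩⟩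
    | blk_bd => exact ⟨by simp, fun h => ⟨by simp, not_bd _ h⟩⟩
    | bd_lone =>
      exact ⟨fun h => hxp _ (congrArg Prod.fst h).symm rfl, fun _ => ⟨by simp, by simp⟩⟩
    | lone_blk => exact ⟨by simp, fun _ => ⟨by simp, by simp⟩⟩
    | blk_blk => exact ⟨by simp, fun _ => ⟨by simp, by simp⟩⟩
  · exact ⟨by simp, by simp⟩

theorem prod_pathIn_bd (hφ : ∀ u v : List A, u ≠ [] → v ≠ [] → φ (u ++ v) = φ u * φ v)
    {p : M2.Q} : ∀ (w : List A) (p₀ : M2.Q),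
    ((prod φ c M1 M2 f1 f2).pathIn ((prod φ c M1 M2 f1 f2).below (some p, none, none))
      (some p₀, none, none) w (some p, none, none) →
      ∃ l, M2.pathIn (M2.below p) p₀ l p ∧ φ w = evalList c l) ∧
    ((prod φ c M1 M2 f1 f2).pathIn ((prod φ c M1 M2 f1 f2).below (some p, none, none))
      (some p₀, some c, none) w (some p, none, none) →
      ∃ l, M2.pathIn (M2.below p) p₀ l p ∧ c * φ w = evalList c l) ∧
    ∀ s q, (prod φ c M1 M2 f1 f2).pathIn ((prod φ c M1 M2 f1 f2).below (some p, none, none))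
      (some p₀, some s, some q) w (some p, none, none) →
      ∃ l, M2.pathIn (M2.below p) p₀ l p ∧ s * φ w = evalList c l
  | [], _ => ⟨fun h => h.elim, fun h => h.elim, fun _ _ h => h.elim⟩
  | [a], p₀ => by
    refine ⟨fun h => ?_, fun h => ?_, fun s q h => ?_⟩ <;>
      change ProdTrans φ c M1 M2 f1 _ a _ at h
    · cases h
    · cases h with
      | lone_bd h => exact ⟨[_], h, rfl⟩
    · cases h with
      | blk_bd _ h => exact ⟨[_], h, rfl⟩
  | a :: b :: w, p₀ => by
    have ih := prod_pathIn_bd hφ (p := p) (b :: w)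
    have hab : φ (a :: b :: w) = φ [a] * φ (b :: w) := hφ [a] (b :: w) (by simp) (by simp)
    refine ⟨?_, ?_, fun s q => ?_⟩
    · rintro ⟨r, hr, ht, hp⟩
      change ProdTrans φ c M1 M2 f1 _ a _ at ht
      cases ht with
      | bd_lone h =>
        obtain ⟨l, hl, e⟩ := (ih _).2.1 hp
        exact ⟨l, hl, by rw [hab, h, e]⟩
    · rintro ⟨r, hr, ht, hp⟩
      change ProdTrans φ c M1 M2 f1 _ a _ at ht
      cases ht with
      | lone_blk =>
        obtain ⟨l, hl, e⟩ := (ih _).2.2 _ _ hp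
        exact ⟨l, hl, by rw [hab, ← mul_assoc, e]⟩
      | lone_bd h =>
        obtain ⟨l, hl, e⟩ := (ih _).1 hp
        exact ⟨_ :: l, pathIn_cons (prod_slt_bd hr) h hl,
          by rw [evalList_cons _ _ (pathIn_ne_nil hl), hab, ← mul_assoc, e]⟩
    · rintro ⟨r, hr, ht, hp⟩
      change ProdTrans φ c M1 M2 f1 _ a _ at ht
      cases ht with
      | blk_blk =>
        obtain ⟨l, hl, e⟩ := (ih _).2.2 _ _ hp
        exact ⟨l, hl, by rw [hab, ← mul_assoc, e]⟩
      | blk_bd _ h =>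
        obtain ⟨l, hl, e⟩ := (ih _).1 hp
        exact ⟨_ :: l, pathIn_cons (prod_slt_bd hr) h hl,
          by rw [evalList_cons _ _ (pathIn_ne_nil hl), hab, ← mul_assoc, e]⟩

theorem prod_G2 (hφ : ∀ u v : List A, u ≠ [] → v ≠ [] → φ (u ++ v) = φ u * φ v)
    (h1 : M1.G2 φ) (h2 : M2.G2 (evalList c)) : (prod φ c M1 M2 f1 f2).G2 φ := by
  have dead : ∀ x, (∀ a y, ¬ (prod φ c M1 M2 f1 f2).trans x a y) →
      ∃ e : S, e * e = e ∧ ∀ w ∈ (prod φ c M1 M2 f1 f2).Lq x, φ w = e := by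
    intro x hx
    obtain ⟨e, he, -⟩ := h1 M1.init
    refine ⟨e, he, fun w hw => absurd hw (not_pathIn_of_invariant (Z := {x}) ?_ w x rfl)⟩
    rintro _ rfl a x' h
    exact absurd h (hx a x')
  rintro ⟨_ | p, _ | s, _ | q⟩
  · refine dead _ fun a y h => ?_
    cases h
  · obtain ⟨e, he, hq⟩ := h1 q
    exact ⟨e, he, fun w hw => eval_loop_le hφ he hq (prod_pathIn_pre w q hw)⟩
  · obtain ⟨e, he, -⟩ := h1 M1.init
    exact ⟨e, he, fun w hw => absurd hw (prod_not_pathIn_lone w)⟩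
  · obtain ⟨e, he, hq⟩ := h1 q
    exact ⟨e, he, fun w hw => eval_loop_le hφ he hq (prod_pathIn_blk w s q hw)⟩
  · obtain ⟨e, he, hp⟩ := h2 p
    refine ⟨e, he, fun w hw => ?_⟩
    obtain ⟨l, hl, h⟩ := (prod_pathIn_bd hφ w p).1 hw
    rw [h]
    exact hp l hl
  · refine dead _ fun a y h => ?_
    cases h
  · obtain ⟨e, he, -⟩ := h1 M1.init
    exact ⟨e, he, fun w hw => absurd hw (prod_not_pathIn_lone w)⟩
  · obtain ⟨e, he, hq⟩ := h1 q
    exact ⟨e, he, fun w hw => eval_loop_le hφ he hq (prod_pathIn_blk w s q hw)⟩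
/-- A run on a block, read from its second letter, carries an accepting run of the first
automaton on the rest of the block. -/
theorem ProdInput.block_run (H : ProdInput φ c M1 M2 f1 f2) {w : ℕ → A} {t : ℕ} {E : ℕ∞}
    {τ : Option M2.Q} {ρ : ℕ → ProdState M1 M2} (htE : ((t + 2 : ℕ) : ℕ∞) ≤ E)
    (hlone : ρ (t + 1) = (τ, some c, none))
    (hstep : ∀ i : ℕ, t + 1 ≤ i → (i : ℕ∞) < E → ProdTrans φ c M1 M2 f1 (ρ i) (w i) (ρ (i + 1)))
    (hletter : ∀ i : ℕ, t + 2 ≤ i → (i : ℕ∞) < E → φ [w i] ≠ c)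
    (hend : ∀ n : ℕ, E = n → ∀ τ s q, ρ n ≠ (τ, some s, some q))
    (hrep : E = ⊤ → ∀ n, ∃ k, n ≤ k ∧ ρ k ∈ (prod φ c M1 M2 f1 f2).rep) :
    (∃ q : ℕ → M1.Q, (((t + 2 : ℕ) : ℕ∞) < E → M1.AccOn w (t + 2) E q) ∧
      ∀ j : ℕ, ((t + 2 + j : ℕ) : ℕ∞) < E →
        ρ (t + 2 + j) = (τ, some (blockValue φ c w t j), some (q (t + 2 + j)))) ∧
    ∀ n : ℕ, E = n → ∃ p p', τ = some p ∧ ρ n = (some p', none, none) ∧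
      M2.trans p (blockValue φ c w t (n - (t + 2))) p' := by
  have hin : ∀ j : ℕ, ((t + 2 + j : ℕ) : ℕ∞) < E →
      ∃ q, ρ (t + 2 + j) = (τ, some (blockValue φ c w t j), some q) ∧ (j = 0 → q = M1.init) := by
    intro j
    induction j with
    | zero =>
      intro hj
      have h := hstep (t + 1) le_rfl (coe_lt_of_le (by omega) hj)
      rw [hlone] at h
      rcases prodTrans_lone h with hx | ⟨p, p', -, -, hx⟩
      · exact ⟨_, hx, fun _ => rfl⟩
      · have h' := hstep (t + 2) (by omega) hj
        rw [show t + 2 = t + 1 + 1 from rfl, hx] at h'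
        exact absurd (prodTrans_bd_letter h').1 (hletter _ le_rfl hj)
    | succ j ih =>
      intro hj
      have hj' := coe_lt_of_le (i := t + 2 + j) (by omega) hj
      obtain ⟨q, hq, -⟩ := ih hj'
      have h := hstep (t + 2 + j) (by omega) hj'
      rw [hq] at h
      rcases prodTrans_blk h with ⟨q', -, hx⟩ | ⟨p, p', -, -, -, hx⟩
      · exact ⟨_, hx, fun h => absurd h (Nat.succ_ne_zero j)⟩
      · have h' := hstep (t + 2 + j + 1) (by omega) hj
        rw [hx] at h'
        exact absurd (prodTrans_bd_letter h').1 (hletter _ (by omega) hj)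
  refine ⟨?_, fun n hn => ?_⟩
  · classical
    let q : ℕ → M1.Q := fun i => if (i : ℕ∞) < E then (ρ i).2.2.getD M1.init else f1
    have hq : ∀ j : ℕ, ((t + 2 + j : ℕ) : ℕ∞) < E →
        ρ (t + 2 + j) = (τ, some (blockValue φ c w t j), some (q (t + 2 + j))) := by
      intro j hj
      obtain ⟨q', h, -⟩ := hin j hj
      simp only [q, if_pos hj, h, Option.getD_some]
    refine ⟨q, fun hlt => ⟨?_, ?_, ?_, ?_⟩, hq⟩
    · obtain ⟨q', h, h'⟩ := hin 0 hlt
      have := (hq 0 hlt).symm.trans h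
      simp only [Prod.mk.injEq, Option.some.injEq, true_and] at this
      exact this.trans (h' rfl)
    · intro i hi hiE
      obtain ⟨j, rfl⟩ := Nat.exists_eq_add_of_le hi
      have h := hstep _ (by omega) hiE
      rw [hq j hiE] at h
      by_cases hs : ((t + 2 + j + 1 : ℕ) : ℕ∞) < E
      · rw [show t + 2 + j + 1 = t + 2 + (j + 1) from rfl, hq (j + 1) hs] at h
        rcases prodTrans_blk h with ⟨q', h, hx⟩ | ⟨p, p', -, -, -, hx⟩
        · simp only [Prod.mk.injEq, Option.some.injEq] at hx
          rw [show t + 2 + j + 1 = t + 2 + (j + 1) from rfl, hx.2.2]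
          exact h
        · simp at hx
      · have hE : E = ((t + 2 + j + 1 : ℕ) : ℕ∞) := le_antisymm (not_lt.1 hs) (coe_succ_le.2 hiE)
        have hq1 : q (t + 2 + j + 1) = f1 := if_neg hs
        have hne := hend _ hE
        rw [hq1]
        rcases prodTrans_blk h with ⟨q', -, hx⟩ | ⟨p, p', -, h, -, hx⟩
        · exact absurd hx (hne _ _ _)
        · exact h
    · rintro n rfl
      simp [q, H.final₁]
    · rintro rfl n
      obtain ⟨k, hk, hr⟩ := hrep rfl (n + (t + 2))
      obtain ⟨j, rfl⟩ := Nat.exists_eq_add_of_le (show t + 2 ≤ k by omega)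
      refine ⟨t + 2 + j, by omega, ?_⟩
      rw [hq j (ENat.natCast_lt_top _)] at hr
      rcases hr with ⟨q', _, h⟩ | ⟨p, _, h⟩ | ⟨τ', s, q', h', _, h⟩
      · simp at h
      · simp at h
      · simp only [Prod.mk.injEq, Option.some.injEq] at h
        rw [h.2.2]
        exact h'
  · subst hn
    have hn : t + 2 ≤ n := by exact_mod_cast htE
    have hne := hend n rfl
    obtain ⟨j, rfl⟩ := Nat.exists_eq_add_of_le hn
    rcases j with _ | j
    · have h := hstep (t + 1) le_rfl (by norm_cast)
      rw [hlone] at h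
      rw [show t + 2 + 0 - (t + 2) = 0 by omega]
      rcases prodTrans_lone h with hx | ⟨p, p', hp, h, hx⟩
      · exact absurd hx (hne _ _ _)
      · exact ⟨p, p', hp, hx, h⟩
    · have hj : ((t + 2 + j : ℕ) : ℕ∞) < ((t + 2 + (j + 1) : ℕ) : ℕ∞) := by norm_cast; omega
      obtain ⟨q, hq, -⟩ := hin j hj
      have h := hstep (t + 2 + j) (by omega) hj
      rw [hq] at h
      rw [show t + 2 + (j + 1) - (t + 2) = j + 1 by omega]
      rcases prodTrans_blk h with ⟨q', -, hx⟩ | ⟨p, p', hp, -, h, hx⟩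
      · exact absurd hx (hne _ _ _)
      · exact ⟨p, p', hp, hx, h⟩

theorem ProdInput.exists_accOn (H : ProdInput φ c M1 M2 f1 f2)
    (hφ : ∀ u v : List A, u ≠ [] → v ≠ [] → φ (u ++ v) = φ u * φ v) (w : ℕ → A) (N : ℕ∞)
    (hN : 0 < N) : ∃ ρ, (prod φ c M1 M2 f1 f2).AccOn w 0 N ρ := by
  classical
  rcases exists_blockCut (fun a => φ [a] = c) w N with ⟨rfl, hP⟩ | ⟨T, K, h⟩
  · obtain ⟨q, hq⟩ := (H.unique₁ w 0 ⊤ hN fun i _ _ => hP i).1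
    refine ⟨fun i => (none, none, some (q i)), ?_, fun i hi hiN => ?_, fun n hn => by simp at hn,
      fun _ n => ?_⟩
    · simp only [hq.start]
    · exact ProdTrans.pre_pre (hq.step i hi hiN)
    · obtain ⟨k, hk, hr⟩ := hq.rep rfl n
      exact ⟨k, hk, Or.inl ⟨_, hr, rfl⟩⟩
  obtain ⟨q, hq0, hq⟩ : ∃ q : ℕ → M1.Q, q 0 = M1.init ∧ (0 < T 0 → M1.AccOn w 0 (T 0) q) := by
    rcases Nat.eq_zero_or_pos (T 0) with h0 | h0
    · exact ⟨fun _ => M1.init, rfl, fun h => absurd h0 h.ne'⟩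
    · obtain ⟨q, hq⟩ := (H.unique₁ w 0 (T 0) (by exact_mod_cast h0)
        fun i _ hi => h.before i (by exact_mod_cast hi)).1
      exact ⟨q, hq.start, fun _ => hq⟩
  have hqf : 0 < T 0 → q (T 0) = f1 := fun h0 => by
    have := (hq h0).final _ rfl
    rwa [H.final₁] at this
  obtain ⟨σ, hσ0, hσ⟩ : ∃ σ : ℕ → M2.Q, σ 0 = M2.init ∧
      (0 < K → M2.AccOn (fun k => blockValue φ c w (T k) (T (k + 1) - (T k + 2))) 0 K σ) := by
    rcases eq_or_ne K 0 with h0 | h0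
    · exact ⟨fun _ => M2.init, rfl, fun h => absurd h0 h.ne'⟩
    · obtain ⟨σ, hσ⟩ := (H.unique₂ (fun k => blockValue φ c w (T k) (T (k + 1) - (T k + 2))) 0 K
        (pos_iff_ne_zero.2 h0) fun k _ hk => h.exists_blockValue hφ k hk).1
      exact ⟨σ, hσ.start, fun _ => hσ⟩
  let τ : ℕ → Option M2.Q := fun k => if K = 0 then none else some (σ k)
  let y : ℕ → ProdState M1 M2 := fun k =>
    if k = 0 then (none, none, some (q (T 0))) else (some (σ k), none, none)
  have hlone : ∀ k : ℕ, (k : ℕ∞) ≤ K → φ [w (T k)] = c →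
      ProdTrans φ c M1 M2 f1 (y k) (w (T k)) (τ k, some c, none) := by
    intro k hk hc
    rcases Nat.eq_zero_or_pos k with rfl | h0
    · refine ProdTrans.pre_lone hc ?_ ?_
      · rcases Nat.eq_zero_or_pos (T 0) with h0 | h0
        · exact Or.inl (h0.symm ▸ hq0)
        · exact Or.inr (hqf h0)
      · simp only [τ, hσ0]
        split_ifs
        · exact Or.inl rfl
        · exact Or.inr rfl
    · have hK : K ≠ 0 := by
        rintro rfl
        exact h0.ne' (by exact_mod_cast nonpos_iff_eq_zero.1 hk)
      simp only [τ, y, if_neg hK, if_neg h0.ne']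
      exact ProdTrans.bd_lone hc
  have hpiece : ∀ k : ℕ, ∃ ρ : ℕ → ProdState M1 M2, (k : ℕ∞) < K → ρ (T k) = y k ∧
      (∀ i, T k ≤ i → i < T (k + 1) → ProdTrans φ c M1 M2 f1 (ρ i) (w i) (ρ (i + 1))) ∧
      ρ (T (k + 1)) = y (k + 1) := by
    intro k
    by_cases hk : (k : ℕ∞) < K
    swap
    · exact ⟨fun _ => y 0, fun h => absurd h hk⟩
    obtain ⟨h1, h2, -, h4⟩ := h.block k hk
    have hK : 0 < K := (zero_le).trans_lt hk
    obtain ⟨ρ, r1, r2, r3, -⟩ := H.exists_block_run (E := T (k + 1)) (y := y (k + 1))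
      (Nat.cast_le.2 h2) (hlone k hk.le h1) (fun i hi hi' => h4 i hi (by exact_mod_cast hi'))
      (fun n hn => by
        obtain rfl := Nat.cast_inj.1 hn
        exact ⟨σ k, σ (k + 1), if_neg hK.ne', if_neg (Nat.succ_ne_zero k),
          (hσ hK).step k (Nat.zero_le _) hk⟩)
    exact ⟨ρ, fun _ => ⟨r1, fun i hi hi' => r2 i hi (by exact_mod_cast hi'), r3 _ rfl⟩⟩
  have htail : ∃ ρ : ℕ → ProdState M1 M2, ∀ k : ℕ, K = k → ρ (T k) = y k ∧
      (∀ i : ℕ, T k ≤ i → (i : ℕ∞) < N → ProdTrans φ c M1 M2 f1 (ρ i) (w i) (ρ (i + 1))) ∧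
      (∀ n : ℕ, N = n → ρ n ∈ (prod φ c M1 M2 f1 f2).final) ∧
      (N = ⊤ → ∀ n, ∃ l, n ≤ l ∧ ρ l ∈ (prod φ c M1 M2 f1 f2).rep) := by
    by_cases hK : K = ⊤
    · exact ⟨fun _ => y 0, fun k hk => absurd (hK.symm.trans hk).symm (ENat.natCast_ne_top k)⟩
    obtain ⟨k, rfl⟩ := ENat.ne_top_iff_exists.1 hK
    have hσf : 0 < k → σ k = f2 := fun h0 => by
      have := (hσ (by exact_mod_cast h0)).final _ rfl
      rwa [H.final₂] at this
    have hτ : τ k = none ∨ τ k = some f2 := by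
      rcases Nat.eq_zero_or_pos k with rfl | h0
      · exact Or.inl (if_pos rfl)
      · exact Or.inr ((if_neg (by exact_mod_cast h0.ne')).trans (congrArg some (hσf h0)))
    rcases h.tail k rfl with hNk | ⟨hc, hNk | ⟨hNk, hl⟩⟩
    · refine ⟨fun _ => y k, fun k' hk' => ?_⟩
      obtain rfl := Nat.cast_inj.1 hk'
      refine ⟨rfl, fun i hi hi' => ?_, fun n _ => ?_, fun ht => ?_⟩
      · rw [hNk] at hi'
        exact absurd (Nat.cast_lt.1 hi') (not_lt.2 hi)
      · rcases Nat.eq_zero_or_pos k with rfl | h0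
        · refine Or.inl ?_
          have : 0 < T 0 := by
            rw [hNk] at hN
            exact_mod_cast hN
          simp only [y, if_true, hqf this]
        · exact Or.inr (Or.inl (by simp only [y, if_neg h0.ne', hσf h0]))
      · exact absurd (hNk.symm.trans ht) (ENat.natCast_ne_top _)
    · refine ⟨fun i => if i ≤ T k then y k else (τ k, some c, none), fun k' hk' => ?_⟩
      obtain rfl := Nat.cast_inj.1 hk'
      refine ⟨if_pos le_rfl, fun i hi hi' => ?_, fun n hn => ?_, fun ht => ?_⟩
      · rw [hNk] at hi'
        obtain rfl : T k = i := le_antisymm hi (Nat.lt_succ_iff.1 (Nat.cast_lt.1 hi'))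
        beta_reduce
        rw [if_pos le_rfl, if_neg (by omega)]
        exact hlone k le_rfl hc
      · rw [hNk] at hn
        obtain rfl := Nat.cast_inj.1 hn
        beta_reduce
        rw [if_neg (by omega)]
        rcases hτ with hτ | hτ
        · exact Or.inr (Or.inr (Or.inl (by rw [hτ])))
        · exact Or.inr (Or.inr (Or.inr (by rw [hτ])))
      · exact absurd (hNk.symm.trans ht) (ENat.natCast_ne_top _)
    · obtain ⟨ρ, r1, r2, -, r4⟩ := H.exists_block_run (E := ⊤) (y := y 0) le_top
        (hlone k le_rfl hc) (fun i hi _ => hl i hi) (fun n hn => by simp at hn)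
      refine ⟨ρ, fun k' hk' => ?_⟩
      obtain rfl := Nat.cast_inj.1 hk'
      refine ⟨r1, fun i hi _ => r2 i hi (ENat.natCast_lt_top i), fun n hn => ?_, fun _ n => ?_⟩
      · exact absurd (hNk.symm.trans hn).symm (ENat.natCast_ne_top n)
      · obtain ⟨l, hl, s, p, hp, he⟩ := r4 rfl n
        exact ⟨l, hl, Or.inr (Or.inr ⟨_, _, p, hp, hτ, he⟩)⟩
  choose Rp hRp using hpiece
  obtain ⟨Rt, hRt⟩ := htail
  let R : ℕ → ℕ → ProdState M1 M2 := fun k => if (k : ℕ∞) < K then Rp k else Rt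
  have hR : ∀ k : ℕ, (k : ℕ∞) ≤ K → R k (T k) = y k := by
    intro k hk
    rcases hk.lt_or_eq with hk | hk
    · simp only [R, if_pos hk]
      exact (hRp k hk).1
    · simp only [R, hk, lt_irrefl, if_false]
      exact (hRt k hk.symm).1
  obtain ⟨ρ, hρ0, hρ⟩ := exists_glue h.mono R (fun k => by
      by_cases hk : (k : ℕ∞) < K
      · rw [hR (k + 1) (coe_succ_le.2 hk)]
        simp only [R, if_pos hk]
        exact (hRp k hk).2.2
      · have hk' : ¬ ((k + 1 : ℕ) : ℕ∞) < K := fun h => hk (coe_lt_of_le (Nat.le_succ k) h)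
        simp only [R, if_neg hk, if_neg hk'])
    (fun i => (none, none, some (q i))) (hR 0 (zero_le)).symm
  have hρt : ∀ k : ℕ, K = k → ∀ i, T k ≤ i → ρ i = Rt i := by
    intro k hk i hi
    obtain ⟨l, hl, hl'⟩ := exists_between h.mono ((h.mono.monotone (Nat.zero_le k)).trans hi)
    have hkl : k ≤ l := Nat.lt_succ_iff.1 (h.mono.lt_iff_lt.1 (hi.trans_lt hl'))
    rw [hρ l i hl hl'.le]
    simp only [R, hk, if_neg (not_lt.2 (Nat.cast_le.2 hkl))]
  refine ⟨ρ, ?_, fun i _ hi => ?_, fun n hn => ?_, fun ht n => ?_⟩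
  · rw [hρ0 0 (Nat.zero_le _), hq0]
  · rcases lt_or_ge i (T 0) with hiT | hiT
    · rw [hρ0 i hiT.le, hρ0 (i + 1) hiT]
      exact ProdTrans.pre_pre ((hq (by omega)).step i (Nat.zero_le _) (Nat.cast_lt.2 hiT))
    · obtain ⟨k, hk, hk'⟩ := exists_between h.mono hiT
      by_cases hkK : (k : ℕ∞) < K
      · rw [hρ k i hk hk'.le, hρ k (i + 1) (by omega) hk']
        simp only [R, if_pos hkK]
        exact (hRp k hkK).2.1 i hk hk'
      · obtain ⟨l, rfl⟩ := ENat.ne_top_iff_exists.1 (ne_top_of_le_ne_top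
          (ENat.natCast_ne_top k) (not_lt.1 hkK))
        have hl : T l ≤ i := (h.mono.monotone (by exact_mod_cast not_lt.1 hkK)).trans hk
        rw [hρt l rfl i hl, hρt l rfl (i + 1) (by omega)]
        exact (hRt l rfl).2.1 i hl hi
  · have hK : K ≠ ⊤ := by
      rintro rfl
      exact absurd (h.eq_top.symm.trans hn).symm (ENat.natCast_ne_top n)
    obtain ⟨k, rfl⟩ := ENat.ne_top_iff_exists.1 hK
    have hkn : T k ≤ n := by
      have := h.le (le_refl (k : ℕ∞))
      rw [hn] at this
      exact_mod_cast this
    rw [hρt k rfl n hkn]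
    exact (hRt k rfl).2.2.1 n hn
  · by_cases hK : K = ⊤
    · obtain ⟨k, hk, hr⟩ := (hσ (by simp [hK])).rep hK (n + 1)
      refine ⟨T k, le_trans (by omega) (h.mono.le_apply (x := k)), Or.inr (Or.inl ⟨_, hr, ?_⟩)⟩
      rw [hρ k _ le_rfl (h.mono (Nat.lt_succ_self k)).le, hR k (by simp [hK])]
      exact if_neg (by omega)
    · obtain ⟨k, rfl⟩ := ENat.ne_top_iff_exists.1 hK
      obtain ⟨l, hl, hr⟩ := (hRt k rfl).2.2.2 ht (n + T k)
      refine ⟨l, by omega, ?_⟩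
      rw [hρt k rfl l (by omega)]
      exact hr

section AccOn

variable {w : ℕ → A} {N K : ℕ∞} {T : ℕ → ℕ} {ρ : ℕ → ProdState M1 M2}

theorem ProdInput.accOn_block (H : ProdInput φ c M1 M2 f1 f2)
    (h : BlockCut (fun a => φ [a] = c) w N T K) (hρ : (prod φ c M1 M2 f1 f2).AccOn w 0 N ρ) {k : ℕ}
    (hk : (k : ℕ∞) < K) {τ : Option M2.Q} (hlone : ρ (T k + 1) = (τ, some c, none)) :
    (∃ q : ℕ → M1.Q, (T k + 2 < T (k + 1) → M1.AccOn w (T k + 2) (T (k + 1)) q) ∧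
      ∀ j : ℕ, T k + 2 + j < T (k + 1) →
        ρ (T k + 2 + j) = (τ, some (blockValue φ c w (T k) j), some (q (T k + 2 + j)))) ∧
    ∃ p p', τ = some p ∧ ρ (T (k + 1)) = (some p', none, none) ∧
      M2.trans p (blockValue φ c w (T k) (T (k + 1) - (T k + 2))) p' := by
  obtain ⟨h1, h2, h3, h4⟩ := h.block k hk
  have := H.block_run (E := T (k + 1)) (Nat.cast_le.2 h2) hlone
    (fun i _ hi => hρ.step i (Nat.zero_le _) (lt_of_lt_of_le hi h3))
    (fun i hi hi' => h4 i hi (Nat.cast_lt.1 hi')) ?_ (fun ht => absurd ht (ENat.natCast_ne_top _))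
  · refine ⟨?_, this.2 _ rfl⟩
    obtain ⟨q, hq, hq'⟩ := this.1
    exact ⟨q, fun hlt => hq (Nat.cast_lt.2 hlt), fun j hj => hq' j (Nat.cast_lt.2 hj)⟩
  · intro n hn τ s q he
    obtain rfl := Nat.cast_inj.1 hn
    rcases h3.lt_or_eq with hlt | heq
    · have hs := hρ.step _ (Nat.zero_le _) hlt
      rw [he] at hs
      have hc := h.letter (coe_succ_le.2 hk) hlt
      rcases prodTrans_blk hs with ⟨q', ht, -⟩ | ⟨p, p', -, ht, -, -⟩
      · exact H.letter _ _ _ ht hc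
      · exact H.letter _ _ _ ht hc
    · have hf := hρ.final _ heq.symm
      rw [he] at hf
      simp at hf

theorem ProdInput.accOn_tail (H : ProdInput φ c M1 M2 f1 f2) {k : ℕ}
    (h : BlockCut (fun a => φ [a] = c) w N T k) (hρ : (prod φ c M1 M2 f1 f2).AccOn w 0 N ρ)
    (hN : (T k : ℕ∞) < N) {τ : Option M2.Q} (hlone : ρ (T k + 1) = (τ, some c, none)) :
    (τ = none ∨ τ = some f2) ∧ (N = (T k + 1 : ℕ) ∨ N = ⊤ ∧ (∀ i, T k + 2 ≤ i → φ [w i] ≠ c) ∧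
      ∃ q : ℕ → M1.Q, M1.AccOn w (T k + 2) ⊤ q ∧ ∀ j : ℕ,
        ρ (T k + 2 + j) = (τ, some (blockValue φ c w (T k) j), some (q (T k + 2 + j)))) := by
  rcases h.tail k rfl with hNk | ⟨-, hNk | ⟨rfl, hl⟩⟩
  · exact absurd hNk hN.ne'
  · refine ⟨?_, Or.inl hNk⟩
    have hf := hρ.final _ hNk
    rw [hlone] at hf
    simpa using hf
  · obtain ⟨⟨q, hq, hq'⟩, -⟩ := H.block_run (E := ⊤) le_top hlone
      (fun i _ hi => hρ.step i (Nat.zero_le _) hi) (fun i hi _ => hl i hi)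
      (fun n hn => absurd hn.symm (ENat.natCast_ne_top n)) (fun _ => hρ.rep rfl)
    refine ⟨?_, Or.inr ⟨rfl, hl, q, hq (ENat.natCast_lt_top _),
      fun j => hq' j (ENat.natCast_lt_top _)⟩⟩
    obtain ⟨l, hlk, hr⟩ := hρ.rep rfl (T k + 2)
    obtain ⟨j, rfl⟩ := Nat.exists_eq_add_of_le hlk
    rw [hq' j (ENat.natCast_lt_top _)] at hr
    rcases hr with ⟨q', _, h⟩ | ⟨p, _, h⟩ | ⟨τ', s, q', _, hτ, h⟩
    · simp at h
    · simp at h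
    · simp only [Prod.mk.injEq] at h
      rwa [h.1]

/-- Before the first letter of value `c` an accepting run simulates the first automaton. -/
theorem prod_accOn_before
    (hρ : (prod φ c M1 M2 f1 f2).AccOn w 0 N ρ) {E : ℕ∞} (hE : E ≤ N)
    (hl : ∀ i : ℕ, (i : ℕ∞) < E → φ [w i] ≠ c) :
    ∃ q : ℕ → M1.Q, q 0 = M1.init ∧ (∀ i : ℕ, (i : ℕ∞) ≤ E → ρ i = (none, none, some (q i))) ∧
      ∀ i : ℕ, (i : ℕ∞) < E → M1.trans (q i) (w i) (q (i + 1)) := by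
  have step : ∀ i : ℕ, (i : ℕ∞) < E → ∀ q, ρ i = (none, none, some q) →
      ∃ q', M1.trans q (w i) q' ∧ ρ (i + 1) = (none, none, some q') := by
    intro i hi q hq
    have hs := hρ.step i (Nat.zero_le _) (lt_of_lt_of_le hi hE)
    rw [hq] at hs
    exact (prodTrans_pre hs).resolve_right fun h' => hl i hi h'.1
  have hpre : ∀ i : ℕ, (i : ℕ∞) ≤ E → ∃ q, ρ i = (none, none, some q) := by
    intro i
    induction i with
    | zero => exact fun _ => ⟨_, hρ.start⟩
    | succ i ih =>
      intro hi
      obtain ⟨q, hq⟩ := ih (coe_succ_le.1 hi).le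
      obtain ⟨q', -, hq'⟩ := step i (coe_succ_le.1 hi) q hq
      exact ⟨q', hq'⟩
  have hq : ∀ i : ℕ, (i : ℕ∞) ≤ E → ρ i = (none, none, some ((ρ i).2.2.getD M1.init)) := by
    intro i hi
    obtain ⟨q, hq⟩ := hpre i hi
    simp [hq]
  refine ⟨fun i => (ρ i).2.2.getD M1.init, ?_, hq, fun i hi => ?_⟩
  · beta_reduce
    rw [hρ.start]
    rfl
  · obtain ⟨q', ht, hq'⟩ := step i hi _ (hq i hi.le)
    simpa only [hq', Option.getD_some] using ht

/-- On a word cut into blocks, an accepting run of the product is an accepting run of the first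
automaton before the blocks, and carries an accepting run of the second one on the sequence of
block values. -/
theorem ProdInput.accOn_blocks (H : ProdInput φ c M1 M2 f1 f2)
    (h : BlockCut (fun a => φ [a] = c) w N T K) (hρ : (prod φ c M1 M2 f1 f2).AccOn w 0 N ρ) :
    ∃ (q : ℕ → M1.Q) (σ : ℕ → M2.Q), q 0 = M1.init ∧ (0 < T 0 → M1.AccOn w 0 (T 0) q) ∧
      (0 < K → M2.AccOn (fun k => blockValue φ c w (T k) (T (k + 1) - (T k + 2))) 0 K σ) ∧
      (∀ i ≤ T 0, ρ i = (none, none, some (q i))) ∧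
      (∀ k : ℕ, (k : ℕ∞) ≤ K → (T k : ℕ∞) < N →
        ρ (T k + 1) = (if K = 0 then none else some (σ k), some c, none)) ∧
      ∀ k : ℕ, (k : ℕ∞) ≤ K → 0 < k → ρ (T k) = (some (σ k), none, none) := by
  classical
  obtain ⟨q, hq0, hq, hqs⟩ := prod_accOn_before hρ h.first_le
    fun i hi => h.before i (Nat.cast_lt.1 hi)
  have hbd : ∀ k : ℕ, (k : ℕ∞) ≤ K → (T k : ℕ∞) < N → ∀ p, ρ (T k) = (some p, none, none) →
      ρ (T k + 1) = (some p, some c, none) := by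
    intro k hk hN p hp
    have hs := hρ.step _ (Nat.zero_le _) hN
    rw [hp] at hs
    exact (prodTrans_bd_letter hs).2
  have hfirst : (T 0 : ℕ∞) < N → (q (T 0) = M1.init ∨ q (T 0) = f1) ∧
      ∃ τ, (τ = none ∨ τ = some M2.init) ∧ ρ (T 0 + 1) = (τ, some c, none) := by
    intro hN
    have hs := hρ.step _ (Nat.zero_le _) hN
    rw [hq _ le_rfl] at hs
    rcases prodTrans_pre hs with ⟨q', ht, -⟩ | ⟨-, h'⟩
    · exact absurd (h.letter (zero_le) hN) (H.letter _ _ _ ht)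
    · exact h'
  have hlt : ∀ k : ℕ, (k : ℕ∞) < K → (T k : ℕ∞) < N := fun k hk =>
    lt_of_lt_of_le (Nat.cast_lt.2 (h.mono (Nat.lt_succ_self k))) (h.le (coe_succ_le.2 hk))
  have hshape : ∀ k : ℕ, (k : ℕ∞) ≤ K → (0 < k → ∃ p, ρ (T k) = (some p, none, none)) ∧
      ((T k : ℕ∞) < N → ∃ τ, ρ (T k + 1) = (τ, some c, none)) := by
    intro k
    induction k with
    | zero =>
      refine fun _ => ⟨fun h => absurd h (lt_irrefl 0), fun hN => ?_⟩
      obtain ⟨-, τ, -, hτ⟩ := hfirst hN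
      exact ⟨τ, hτ⟩
    | succ k ih =>
      intro hk
      have hk' := coe_succ_le.1 hk
      obtain ⟨τ, hτ⟩ := (ih hk'.le).2 (hlt k hk')
      obtain ⟨-, p, p', -, hp', -⟩ := H.accOn_block h hρ hk' hτ
      exact ⟨fun _ => ⟨p', hp'⟩, fun hN => ⟨_, hbd _ hk hN _ hp'⟩⟩
  let σ : ℕ → M2.Q := fun k => if k = 0 then M2.init else (ρ (T k)).1.getD M2.init
  have hσ : ∀ k : ℕ, (k : ℕ∞) ≤ K → 0 < k → ρ (T k) = (some (σ k), none, none) := by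
    intro k hk h0
    obtain ⟨p, hp⟩ := (hshape k hk).1 h0
    simp [σ, h0.ne', hp]
  have hlone : ∀ k : ℕ, (k : ℕ∞) ≤ K → (T k : ℕ∞) < N →
      ρ (T k + 1) = (if K = 0 then none else some (σ k), some c, none) := by
    intro k hk hN
    rcases Nat.eq_zero_or_pos k with rfl | h0
    · obtain ⟨-, τ, hτ, hl⟩ := hfirst hN
      rw [hl]
      by_cases hK : K = 0
      · subst hK
        rw [if_pos rfl]
        rcases hτ with rfl | rfl
        · rfl
        · rcases (H.accOn_tail (k := 0) h hρ hN hl).1 with h' | h'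
          · simp at h'
          · exact absurd (Option.some.inj h').symm H.ne₂
      · rw [if_neg hK]
        obtain ⟨-, p, p', rfl, -, -⟩ := H.accOn_block h hρ (pos_iff_ne_zero.2 hK) hl
        simpa [σ] using hτ
    · have hK : K ≠ 0 := by
        rintro rfl
        exact h0.ne' (by exact_mod_cast nonpos_iff_eq_zero.1 hk)
      rw [if_neg hK]
      exact hbd k hk hN _ (hσ k hk h0)
  have hσs : ∀ k : ℕ, (k : ℕ∞) < K →
      M2.trans (σ k) (blockValue φ c w (T k) (T (k + 1) - (T k + 2))) (σ (k + 1)) := by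
    intro k hk
    have hK : K ≠ 0 := (zero_le.trans_lt hk).ne'
    have hl := hlone k hk.le (hlt k hk)
    rw [if_neg hK] at hl
    obtain ⟨-, p, p', hp, hp', ht⟩ := H.accOn_block h hρ hk hl
    rw [hσ (k + 1) (coe_succ_le.2 hk) (Nat.succ_pos k)] at hp'
    simp only [Prod.mk.injEq, Option.some.injEq, and_true] at hp hp'
    rwa [hp, hp']
  refine ⟨q, σ, hq0, fun h0 => ⟨hq0, fun i _ hi => hqs i hi, fun n hn => ?_,
      fun ht => absurd ht (ENat.natCast_ne_top _)⟩, fun hK => ⟨if_pos rfl, fun k _ hk => hσs k hk,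
      ?_, ?_⟩, fun i hi => hq i (Nat.cast_le.2 hi), hlone, hσ⟩
  · obtain rfl := Nat.cast_inj.1 hn
    rw [H.final₁, Set.mem_singleton_iff]
    rcases h.first_le.lt_or_eq with hN | hN
    · refine (hfirst hN).1.resolve_left fun hi => ?_
      obtain ⟨m, hm⟩ := Nat.exists_eq_succ_of_ne_zero h0.ne'
      have ht := hqs m (Nat.cast_lt.2 (by omega))
      rw [show m + 1 = T 0 from hm.symm, hi] at ht
      exact H.init_in _ _ ht
    · have hf := hρ.final _ hN.symm
      rw [hq _ le_rfl] at hf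
      simpa using hf
  · rintro k rfl
    have h0 : 0 < k := by exact_mod_cast hK
    rw [H.final₂, Set.mem_singleton_iff]
    rcases (h.le (le_refl (k : ℕ∞))).lt_or_eq with hN | hN
    · have hl := hlone k le_rfl hN
      rw [if_neg hK.ne'] at hl
      simpa using (H.accOn_tail h hρ hN hl).1
    · have hf := hρ.final _ hN.symm
      rw [hσ k le_rfl h0] at hf
      simpa using hf
  · rintro rfl n
    obtain rfl := h.eq_top
    obtain ⟨l, hl, hr⟩ := hρ.rep rfl (T (n + 1))
    obtain ⟨k, hk, hk'⟩ := exists_between h.mono ((h.mono.monotone (Nat.zero_le _)).trans hl)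
    have hnk : n + 1 ≤ k := Nat.lt_succ_iff.1 (h.mono.lt_iff_lt.1 (hl.trans_lt hk'))
    refine ⟨k, by omega, ?_⟩
    have hlo := hlone k le_top (ENat.natCast_lt_top _)
    rw [if_neg ENat.top_ne_zero] at hlo
    rcases (show l = T k ∨ l = T k + 1 ∨ T k + 2 ≤ l by omega) with rfl | rfl | hl2
    · rw [hσ k le_top (by omega)] at hr
      simpa using hr
    · rw [hlo] at hr
      simp at hr
    · obtain ⟨⟨q', -, hq'⟩, -⟩ := H.accOn_block h hρ (ENat.natCast_lt_top k) hlo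
      obtain ⟨j, rfl⟩ := Nat.exists_eq_add_of_le hl2
      rw [hq' j hk'] at hr
      have hf : σ k = f2 := by
        rcases hr with ⟨q', _, h⟩ | ⟨p, _, h⟩ | ⟨τ', s, q', _, hτ, h⟩
        · simp at h
        · simp at h
        · simp only [Prod.mk.injEq] at h
          rw [← h.1] at hτ
          simpa using hτ
      have ht := hσs k (ENat.natCast_lt_top k)
      rw [hf] at ht
      exact absurd ht (H.out₂ _ _)

theorem ProdInput.accOn_unique (H : ProdInput φ c M1 M2 f1 f2)
    (hφ : ∀ u v : List A, u ≠ [] → v ≠ [] → φ (u ++ v) = φ u * φ v) {ρ' : ℕ → ProdState M1 M2}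
    (hρ : (prod φ c M1 M2 f1 f2).AccOn w 0 N ρ) (hρ' : (prod φ c M1 M2 f1 f2).AccOn w 0 N ρ')
    (i : ℕ) (hi : (i : ℕ∞) ≤ N) : ρ i = ρ' i := by
  rcases exists_blockCut (fun a => φ [a] = c) w N with ⟨rfl, hP⟩ | ⟨T, K, h⟩
  · have key : ∀ ρ, (prod φ c M1 M2 f1 f2).AccOn w 0 ⊤ ρ →
        ∃ q : ℕ → M1.Q, M1.AccOn w 0 ⊤ q ∧ ∀ i : ℕ, ρ i = (none, none, some (q i)) := by
      intro ρ hρ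
      obtain ⟨q, hq0, hq, hqs⟩ := prod_accOn_before hρ le_rfl fun i _ => hP i
      refine ⟨q, ⟨hq0, fun i _ hi => hqs i hi, fun n hn => by simp at hn, fun _ n => ?_⟩,
        fun i => hq i le_top⟩
      obtain ⟨l, hl, hr⟩ := hρ.rep rfl n
      rw [hq l le_top] at hr
      exact ⟨l, hl, by simpa using hr⟩
    obtain ⟨q, hq, he⟩ := key ρ hρ
    obtain ⟨q', hq', he'⟩ := key ρ' hρ'
    rw [he, he', (H.unique₁ w 0 ⊤ (by simp) fun i _ _ => hP i).2 q q' hq hq' i (Nat.zero_le _)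
      le_top]
  obtain ⟨q, σ, hq0, hq, hσ, hb, hl, hs⟩ := H.accOn_blocks h hρ
  obtain ⟨q', σ', hq0', hq', hσ', hb', hl', hs'⟩ := H.accOn_blocks h hρ'
  have hσe : K ≠ 0 → ∀ k : ℕ, (k : ℕ∞) ≤ K → σ k = σ' k := fun hK k hk =>
    (H.unique₂ _ 0 K (pos_iff_ne_zero.2 hK) fun k _ hk => h.exists_blockValue hφ k hk).2 σ σ'
      (hσ (pos_iff_ne_zero.2 hK)) (hσ' (pos_iff_ne_zero.2 hK)) k (Nat.zero_le _) hk
  have hbe : ∀ i ≤ T 0, ρ i = ρ' i := by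
    intro i hi
    rw [hb i hi, hb' i hi]
    rcases Nat.eq_zero_or_pos (T 0) with h0 | h0
    · obtain rfl : i = 0 := by omega
      rw [hq0, hq0']
    · rw [(H.unique₁ w 0 (T 0) (Nat.cast_lt.2 h0)
        fun i _ hi => h.before i (Nat.cast_lt.1 hi)).2 q q' (hq h0) (hq' h0) i (Nat.zero_le _)
        (Nat.cast_le.2 hi)]
  have hse : ∀ k : ℕ, (k : ℕ∞) ≤ K → ρ (T k) = ρ' (T k) := by
    intro k hk
    rcases Nat.eq_zero_or_pos k with rfl | h0
    · exact hbe _ le_rfl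
    · have hK : K ≠ 0 := by
        rintro rfl
        exact h0.ne' (by exact_mod_cast nonpos_iff_eq_zero.1 hk)
      rw [hs k hk h0, hs' k hk h0, hσe hK k hk]
  have hle : ∀ k : ℕ, (k : ℕ∞) ≤ K → (T k : ℕ∞) < N → ρ (T k + 1) = ρ' (T k + 1) := by
    intro k hk hN
    rw [hl k hk hN, hl' k hk hN]
    split_ifs with hK
    · rfl
    · rw [hσe hK k hk]
  rcases le_or_gt i (T 0) with hi0 | hi0
  · exact hbe i hi0
  obtain ⟨k, hk, hk'⟩ := exists_between h.mono hi0.le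
  rcases lt_or_ge (k : ℕ∞) K with hkK | hkK
  · have hN : (T k : ℕ∞) < N := lt_of_lt_of_le (Nat.cast_lt.2 (h.mono (Nat.lt_succ_self k)))
      (h.le (coe_succ_le.2 hkK))
    rcases (show i = T k ∨ i = T k + 1 ∨ T k + 2 ≤ i by omega) with rfl | rfl | hi2
    · exact hse k hkK.le
    · exact hle k hkK.le hN
    · obtain ⟨j, rfl⟩ := Nat.exists_eq_add_of_le hi2
      have hlk := hl k hkK.le hN
      obtain ⟨⟨r, hr, hre⟩, -⟩ := H.accOn_block h hρ hkK hlk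
      obtain ⟨⟨r', hr', hre'⟩, -⟩ := H.accOn_block h hρ' hkK ((hle k hkK.le hN).symm.trans hlk)
      have hlt : T k + 2 < T (k + 1) := by omega
      rw [hre j hk', hre' j hk', (H.unique₁ w (T k + 2) (T (k + 1)) (Nat.cast_lt.2 hlt)
        fun i hi hi' => (h.block k hkK).2.2.2 i hi (Nat.cast_lt.1 hi')).2 r r' (hr hlt) (hr' hlt) _
        hi2 (Nat.cast_le.2 hk'.le)]
  · obtain ⟨m, rfl⟩ := ENat.ne_top_iff_exists.1 (ne_top_of_le_ne_top (ENat.natCast_ne_top k) hkK)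
    have hm : T m ≤ i := (h.mono.monotone (Nat.cast_le.1 hkK)).trans hk
    rcases hm.eq_or_lt with rfl | hm
    · exact hse m le_rfl
    have hN : (T m : ℕ∞) < N := lt_of_lt_of_le (Nat.cast_lt.2 hm) hi
    rcases (show i = T m + 1 ∨ T m + 2 ≤ i by omega) with rfl | hi2
    · exact hle m le_rfl hN
    · have hlm := hl m le_rfl hN
      rcases (H.accOn_tail h hρ hN hlm).2 with hNm | ⟨rfl, hlet, r, hr, hre⟩
      · rw [hNm] at hi
        have := Nat.cast_le.1 hi
        omega
      rcases (H.accOn_tail h hρ' hN ((hle m le_rfl hN).symm.trans hlm)).2 with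
        hNm | ⟨-, -, r', hr', hre'⟩
      · exact absurd hNm.symm (ENat.natCast_ne_top _)
      obtain ⟨j, rfl⟩ := Nat.exists_eq_add_of_le hi2
      rw [hre j, hre' j, (H.unique₁ w (T m + 2) ⊤ (ENat.natCast_lt_top _)
        fun i hi _ => hlet i hi).2 r r' hr hr' _ hi2 le_top]

end AccOn

theorem ProdInput.prod_G1 (H : ProdInput φ c M1 M2 f1 f2)
    (hφ : ∀ u v : List A, u ≠ [] → v ≠ [] → φ (u ++ v) = φ u * φ v) :
    (prod φ c M1 M2 f1 f2).G1 :=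
  (G1_iff _).2 fun w N hN => ⟨H.exists_accOn hφ w N hN, fun _ _ h h' => H.accOn_unique hφ h h'⟩

end Product

end Auto
/-- **Second inductive case** `cS ⊊ S`. Given a good automaton `M1` for the
restriction of `φ` to `Σ₁ = Σ \ φ⁻¹(c)` and a good automaton `M2` over the
alphabet `B = φ(Σ₂ΣΣ₁*) ⊆ cS` for the evaluation morphism `ψ : B⁺ → cS`, there
is a `φ`-weakly-good automaton with state set
`(Q₂ ∪ {⊥}) × (S ∪ {⊥}) × (Q₁ ∪ {⊥})`. -/
theorem inductive_case_cS {A S : Type} [Fintype A] [Semigroup S] [Fintype S]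
    (φ : List A → S)
    (hφ : ∀ u v : List A, u ≠ [] → v ≠ [] → φ (u ++ v) = φ u * φ v)
    (c : S) (hc : ∃ a : A, φ [a] = c)
    (hcS : (Set.range fun s : S => c * s) ≠ Set.univ)
    (hSigma1 : ∃ a : A, φ [a] ≠ c)
    (M1 : Auto {a : A // φ [a] ≠ c})
    (h1 : M1.Good fun w : List {a : A // φ [a] ≠ c} => φ (w.map Subtype.val))
    (M2 : Auto {x : S // x ∈ φ '' {w : List A | ∃ (b : A) (a : A) (u : List A),
        w = b :: a :: u ∧ φ [b] = c ∧ ∀ y ∈ u, φ [y] ≠ c}})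
    (h2 : M2.Good fun l => evalList c (l.map Subtype.val)) :
    ∃ M : Auto A, M.WeaklyGood φ ∧
      Nonempty (M.Q ≃ (Option M2.Q × Option S × Option M1.Q)) := by
  obtain ⟨⟨hG1, hG2, hin, hmax⟩, f1, hf1, -, -, -⟩ := h1
  obtain ⟨⟨hG1', hG2', -, -⟩, f2, hf2, hout, hlt, -⟩ := h2
  have H : Auto.ProdInput φ c M1.extend M2.extend f1 f2 :=
    { letter := fun _ _ _ h => h.1
      init_in := fun _ _ h => hin _ _ h.2
      final₁ := hf1
      unique₁ := Auto.uniqueAccOn_extend M1 hG1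
      final₂ := hf2
      out₂ := fun _ _ h => hout _ _ h.2
      ne₂ := by
        rintro rfl
        let := M2.lin
        exact lt_irrefl (α := M2.Q) _ hlt
      unique₂ := fun w m N hm hw => Auto.uniqueAccOn_extend M2 hG1' w m N hm fun i hi hiN => by
        obtain ⟨b, a, u, hb, hu, he⟩ := hw i hi hiN
        exact ⟨_, ⟨b, a, u, rfl, hb, hu⟩, he⟩ }
  exact ⟨Auto.prod φ c M1.extend M2.extend f1 f2,
    ⟨H.prod_G1 hφ, Auto.prod_G2 hφ (Auto.extend_G2 M1 φ hG2) (Auto.extend_G2 M2 (evalList c) hG2'),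
      Auto.prod_G3 hmax fun p a h => hin p _ h.2⟩, ⟨Equiv.refl _⟩⟩
end

section
/- For every semigroup morphism φ: Σ⁺ → S from the nonempty words over a finite alphabet Σ to a finite semigroup S, there exists N ∈ ℕ such that every finite or infinite word w ∈ Σ^∞ admits a Ramsey split of height at most N. -/
/-- `σ`-equivalence of positions `i, j` of a split `σ` (finite-word version):
`σ i = σ j` and no position between them has a larger `σ`-value. -/
def SplitEquivFin {n : ℕ} (σ : Fin n → ℕ) (i j : Fin n) : Prop :=
  σ i = σ j ∧ ∀ k : Fin n, min i j ≤ k → k ≤ max i j → σ k ≤ σ i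

/-- `σ`-equivalence of positions of a split of an infinite word. -/
def SplitEquivInf (σ : ℕ → ℕ) (i j : ℕ) : Prop :=
  σ i = σ j ∧ ∀ k : ℕ, min i j ≤ k → k ≤ max i j → σ k ≤ σ i

/-- The factor `w(i,j] = a_{i+1} ⋯ a_j` of a finite word `w = a₁a₂⋯`. -/
def sliceFin {A : Type} (w : List A) (i j : ℕ) : List A :=
  (w.drop i).take (j - i)

/-- The factor `w(i,j]` of an infinite word `w`. -/
def sliceInf {A : Type} (w : ℕ → A) (i j : ℕ) : List A :=
  (List.range (j - i)).map fun t => w (i + t)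

/-- A split `σ` of a finite word `w` is Ramsey for `φ`: the `φ`-images of
factors between `σ`-equivalent positions in the same class agree and are
idempotent. -/
def RamseyFin {A S : Type} [Semigroup S] (φ : List A → S) (w : List A)
    (σ : Fin (w.length + 1) → ℕ) : Prop :=
  ∀ i j i' j' : Fin (w.length + 1), i < j → i' < j' →
    SplitEquivFin σ i j → SplitEquivFin σ i' j' → SplitEquivFin σ i i' →
    φ (sliceFin w (i : ℕ) (j : ℕ)) = φ (sliceFin w (i' : ℕ) (j' : ℕ)) ∧
    φ (sliceFin w (i : ℕ) (j : ℕ)) * φ (sliceFin w (i : ℕ) (j : ℕ)) =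
      φ (sliceFin w (i : ℕ) (j : ℕ))

/-- A split `σ` of an infinite word `w` is Ramsey for `φ`. -/
def RamseyInf {A S : Type} [Semigroup S] (φ : List A → S) (w : ℕ → A)
    (σ : ℕ → ℕ) : Prop :=
  ∀ i j i' j' : ℕ, i < j → i' < j' →
    SplitEquivInf σ i j → SplitEquivInf σ i' j' → SplitEquivInf σ i i' →
    φ (sliceInf w i j) = φ (sliceInf w i' j') ∧
    φ (sliceInf w i j) * φ (sliceInf w i j) = φ (sliceInf w i j)

/-- `FactorsThrough a b` says that `a` lies in the two-sided ideal generated by `b`. -/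
def FactorsThrough {M : Type*} [Monoid M] (a b : M) : Prop :=
  ∃ u v : M, a = u * b * v

theorem FactorsThrough.refl {M : Type*} [Monoid M] (a : M) : FactorsThrough a a :=
  ⟨1, 1, by simp⟩

theorem FactorsThrough.trans {M : Type*} [Monoid M] {a b c : M}
    (hab : FactorsThrough a b) (hbc : FactorsThrough b c) : FactorsThrough a c := by
  obtain ⟨u, v, rfl⟩ := hab
  obtain ⟨u', v', rfl⟩ := hbc
  exact ⟨u * u', v' * v, by simp only [mul_assoc]⟩

theorem exists_pow_isIdempotentElem {M : Type*} [Monoid M] [Finite M] (x : M) :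
    ∃ n : ℕ, IsIdempotentElem (x ^ (n + 1)) := by
  obtain ⟨p, q, hpq, h⟩ := Finite.exists_ne_map_eq_of_infinite (fun n : ℕ => x ^ n)
  wlog hlt : p < q generalizing p q
  · exact this q p hpq.symm h.symm (by omega)
  obtain ⟨d, rfl⟩ := Nat.exists_eq_add_of_lt hlt
  have period : ∀ k c : ℕ, x ^ (p + c + k * (d + 1)) = x ^ (p + c) := by
    intro k
    induction k with
    | zero => simp
    | succ k ih =>
      intro c
      have h1 : p + c + (k + 1) * (d + 1) = (p + d + 1) + (c + k * (d + 1)) := by ring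
      rw [h1, pow_add, ← (show x ^ p = x ^ (p + d + 1) from h), ← pow_add, ← add_assoc, ih]
  refine ⟨p * (d + 1) + d, ?_⟩
  have hm : p * (d + 1) + d + 1 = p + (p * d + d + 1) := by ring
  have h2 := period (p + 1) (p * d + d + 1)
  rw [← hm] at h2
  rw [IsIdempotentElem, ← pow_add]
  convert h2 using 2
  ring

/-- Left stability of finite monoids. -/
theorem FactorsThrough.exists_eq_mul_left {M : Type*} [Monoid M] [Finite M] {e x : M}
    (h : FactorsThrough e (x * e)) : ∃ c, e = c * (x * e) := by
  obtain ⟨u, v, h⟩ := h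
  obtain ⟨n, hn⟩ := exists_pow_isIdempotentElem (u * x)
  have iter : ∀ k : ℕ, e = (u * x) ^ k * e * v ^ k := by
    intro k
    induction k with
    | zero => simp
    | succ k ih =>
      calc e = (u * x) ^ k * (u * (x * e) * v) * v ^ k := by rw [← h]; exact ih
        _ = (u * x) ^ (k + 1) * e * v ^ (k + 1) := by
          rw [pow_succ (u * x), pow_succ' v]; simp only [mul_assoc]
  have fixed : (u * x) ^ (n + 1) * e = e := by
    have h1 := iter (n + 1)
    calc (u * x) ^ (n + 1) * e
        = (u * x) ^ (n + 1) * ((u * x) ^ (n + 1) * e * v ^ (n + 1)) := by rw [← h1]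
      _ = ((u * x) ^ (n + 1) * (u * x) ^ (n + 1)) * e * v ^ (n + 1) := by simp only [mul_assoc]
      _ = e := by rw [hn.eq, ← h1]
  refine ⟨(u * x) ^ n * u, ?_⟩
  rw [← mul_assoc, mul_assoc _ u x, ← pow_succ, fixed]

/-- Right stability of finite monoids. -/
theorem FactorsThrough.exists_eq_mul_right {M : Type*} [Monoid M] [Finite M] {e x : M}
    (h : FactorsThrough e (e * x)) : ∃ c, e = e * x * c := by
  obtain ⟨u, v, h⟩ := h
  have : Finite Mᵐᵒᵖ := Finite.of_equiv M MulOpposite.opEquiv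
  have hop : FactorsThrough (MulOpposite.op e) (MulOpposite.op x * MulOpposite.op e) :=
    ⟨MulOpposite.op v, MulOpposite.op u, by
      rw [← MulOpposite.op_mul, ← MulOpposite.op_mul, ← MulOpposite.op_mul, ← mul_assoc, ← h]⟩
  obtain ⟨c, hc⟩ := hop.exists_eq_mul_left
  exact ⟨c.unop, by simpa using congrArg MulOpposite.unop hc⟩

/-- In a finite monoid, two elements `e`, `e'` that both start with `b` and are both right units
of `a` coincide and are idempotent, provided `e` lies in the ideal of `a` and `b` in that of `e`. -/
theorem eq_and_idempotent_of_factorsThrough {M : Type*} [Monoid M] [Finite M]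
    {a b e e' r r' : M} (hr : e = b * r) (hr' : e' = b * r') (ha : a = a * e) (ha' : a = a * e')
    (hea : FactorsThrough e a) (hbe : FactorsThrough b e) :
    e = e' ∧ e * e = e := by
  obtain ⟨c, hc⟩ := (show FactorsThrough e (a * e) by rwa [← ha]).exists_eq_mul_left
  rw [← ha] at hc
  obtain ⟨z, hz⟩ := (show FactorsThrough b (b * r) by rwa [← hr]).exists_eq_mul_right
  rw [← hr] at hz
  have idem : e * e = e := by
    nth_rewrite 1 [hc]
    rw [mul_assoc, ← ha, ← hc]
  have h1 : e * e' = e := by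
    nth_rewrite 1 [hc]
    rw [mul_assoc, ← ha', ← hc]
  have h2 : e * b = b := by
    rw [hz, ← mul_assoc, idem]
  have h3 : e * e' = e' := by
    rw [hr', ← mul_assoc, h2]
  exact ⟨h1.symm.trans h3, idem⟩

/-- A finite colouring of a set `C` of positions, cut into convex blocks by `s`, such that equally
coloured pairs in a block carry the same idempotent, provided all labels in `C` generate
the same two-sided ideal. -/
theorem exists_coloring_of_factorsThrough {M : Type*} [Monoid M] [Finite M]
    (f : ℕ → ℕ → M) (hf : ∀ x y z, x ≤ y → y ≤ z → f x z = f x y * f y z)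
    (s : ℕ → ℕ) (C : Set ℕ) (hmin : ∀ x, ∃ x₀ ∈ C, x₀ ≤ x ∧ s x₀ = s x)
    (hC : ∀ x ∈ C, ∀ y ∈ C, ∀ x' ∈ C, ∀ y' ∈ C, x < y → x' < y' → s x = s y → s x' = s y' →
      s x = s x' → FactorsThrough (f x y) (f x' y')) :
    ∃ col : ℕ → M × M, ∀ i ∈ C, ∀ j ∈ C, ∀ i' ∈ C, ∀ j' ∈ C, i < j → i' < j' →
      s i = s j → s i' = s j' → s i = s i' → col i = col j → col i' = col j' → col i = col i' →
      f i j = f i' j' ∧ f i j * f i j = f i j := by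
  classical
  let base : ℕ → ℕ := fun b => sInf {x | x ∈ C ∧ s x = b}
  let next : ℕ → ℕ := fun x => sInf {y | y ∈ C ∧ x < y ∧ s x = s y}
  have hbase : ∀ x, base (s x) ∈ C ∧ s (base (s x)) = s x ∧ base (s x) ≤ x := by
    intro x
    obtain ⟨x₀, h1, h2, h3⟩ := hmin x
    have hm : base (s x) ∈ {y | y ∈ C ∧ s y = s x} := Nat.sInf_mem ⟨x₀, h1, h3⟩
    exact ⟨hm.1, hm.2, (Nat.sInf_le (show x₀ ∈ {y | y ∈ C ∧ s y = s x} from ⟨h1, h3⟩)).trans h2⟩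
  have hnext : ∀ x y, y ∈ C → x < y → s x = s y →
      next x ∈ C ∧ x < next x ∧ s x = s (next x) ∧ next x ≤ y := by
    intro x y h1 h2 h3
    have hy : y ∈ {y | y ∈ C ∧ x < y ∧ s x = s y} := ⟨h1, h2, h3⟩
    have hm : next x ∈ {y | y ∈ C ∧ x < y ∧ s x = s y} := Nat.sInf_mem ⟨y, hy⟩
    exact ⟨hm.1, hm.2.1, hm.2.2, Nat.sInf_le hy⟩
  refine ⟨fun x => (f (base (s x)) x, f x (next x)), ?_⟩
  intro i hi j hj i' hi' j' hj' hij hij' sij sij' sii' cij cij' cii'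
  simp only [Prod.mk.injEq] at cij cij' cii'
  obtain ⟨b1, b2, b3⟩ := hbase i
  obtain ⟨n1, n2, n3, n4⟩ := hnext i j hj hij sij
  obtain ⟨n1', n2', n3', n4'⟩ := hnext i' j' hj' hij' sij'
  rw [← sij] at cij
  rw [← sij', ← sii'] at cij'
  rw [← sii'] at cii'
  have b3' : base (s i) ≤ i' := by rw [sii']; exact (hbase i').2.2
  have hj0 : f (base (s i)) i = f (base (s i)) i * f i j := by
    rw [← hf _ _ _ b3 hij.le]; exact cij.1
  have hj0' : f (base (s i)) i = f (base (s i)) i * f i' j' := by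
    rw [cii'.1, ← hf _ _ _ b3' hij'.le]; exact cij'.1
  refine eq_and_idempotent_of_factorsThrough (a := f (base (s i)) i) (b := f i (next i))
    (r' := f (next i') j') (hf _ _ _ n2.le n4) ?_ hj0 hj0' ?_ ?_
  · rw [cii'.2]; exact hf _ _ _ n2'.le n4'
  · rw [cij.1]; exact hC _ hi _ hj _ b1 _ hj hij (by omega) sij (by omega) (by omega)
  · exact hC _ hi _ n1 _ hi _ hj n2 hij n3 sij rfl

/-- Greedy refinement of a block decomposition `s` by a factor-closed set `V` of labels: `t n` is the
first position of the refined block of `n`. -/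
theorem exists_block_refinement {M : Type*} [Monoid M] (V : Set M)
    (hV : ∀ x y, x * y ∈ V → x ∈ V ∧ y ∈ V)
    (f : ℕ → ℕ → M) (hf : ∀ x y z, x ≤ y → y ≤ z → f x z = f x y * f y z)
    (s : ℕ → ℕ) (hs : Monotone s) :
    ∃ t : ℕ → ℕ, Monotone t ∧ (∀ n, t n ≤ n) ∧ (∀ n, t (t n) = t n) ∧ (∀ n, s (t n) = s n) ∧
      (∀ x y, x < y → t x = t y → f x y ∈ V) ∧
      (∀ x y, x < y → t x = x → t y = y → s x = s y → f x y ∉ V) := by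
  classical
  let t : ℕ → ℕ := fun n => Nat.rec 0
    (fun n m => if s m = s (n + 1) ∧ f m (n + 1) ∈ V then m else n + 1) n
  have t_succ : ∀ n, t (n + 1) =
      if s (t n) = s (n + 1) ∧ f (t n) (n + 1) ∈ V then t n else n + 1 := fun n => rfl
  have t_le : ∀ n, t n ≤ n := by
    intro n
    induction n with
    | zero => exact le_rfl
    | succ n ih => rw [t_succ]; split_ifs <;> omega
  have t_mono : Monotone t := by
    refine monotone_nat_of_le_succ fun n => ?_
    have := t_le n
    rw [t_succ]; split_ifs <;> omega
  have t_t : ∀ n, t (t n) = t n := by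
    intro n
    induction n with
    | zero => rfl
    | succ n ih =>
      by_cases h : s (t n) = s (n + 1) ∧ f (t n) (n + 1) ∈ V
      · rw [t_succ, if_pos h, ih]
      · have h1 : t (n + 1) = n + 1 := by rw [t_succ, if_neg h]
        rw [h1, h1]
  have s_t : ∀ n, s (t n) = s n := by
    intro n
    cases n with
    | zero => rfl
    | succ n => rw [t_succ]; split_ifs with h; exacts [h.1, rfl]
  have t_mem : ∀ n, t n < n → f (t n) n ∈ V := by
    intro n hn
    cases n with
    | zero => omega
    | succ n =>
      rw [t_succ] at hn ⊢
      split_ifs at hn ⊢ with h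
      · exact h.2
      · omega
  refine ⟨t, t_mono, t_le, t_t, s_t, ?_, ?_⟩
  · intro x y hxy h
    have hx := t_le x
    have := t_mem y (by omega)
    rw [← h, hf _ x y hx hxy.le] at this
    exact (hV _ _ this).2
  · intro x y hxy hx hy hsxy hmem
    obtain ⟨m, rfl⟩ : ∃ m, y = m + 1 := ⟨y - 1, by omega⟩
    have h1 : x ≤ t m := by rw [← hx]; exact t_mono (by omega)
    have h2 := t_le m
    have h3 : s (t m) = s (m + 1) :=
      le_antisymm (hs (by omega)) (hsxy ▸ hs h1)
    rw [hf x (t m) (m + 1) h1 (by omega)] at hmem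
    have h4 := t_succ m
    rw [if_pos ⟨h3, (hV _ _ hmem).2⟩] at h4
    omega

/-- Ramsey splits for additive labellings of `ℕ` by a finite monoid, relative to a convex block
decomposition `s` all of whose blocks have labels in a factor-closed set `U`. -/
theorem exists_ramsey_split_of_labels_mem {M : Type*} [Monoid M] [Finite M] (U : Set M) :
    (∀ x y, x * y ∈ U → x ∈ U ∧ y ∈ U) →
    ∃ N : ℕ, ∀ f : ℕ → ℕ → M, (∀ x y z, x ≤ y → y ≤ z → f x z = f x y * f y z) →
      ∀ s : ℕ → ℕ, Monotone s → (∀ x y, x < y → s x = s y → f x y ∈ U) →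
      ∃ σ : ℕ → ℕ, (∀ i, 1 ≤ σ i ∧ σ i ≤ N) ∧
        ∀ i j i' j', i < j → i' < j' → s i = s j → s i' = s j' → s i = s i' →
          SplitEquivInf σ i j → SplitEquivInf σ i' j' → SplitEquivInf σ i i' →
          f i j = f i' j' ∧ f i j * f i j = f i j := by
  classical
  induction U using WellFoundedLT.induction with
  | _ U ih =>
  intro hU
  rcases U.eq_empty_or_nonempty with rfl | hne
  · exact ⟨1, fun f _ s _ h => ⟨fun _ => 1, fun _ => ⟨le_rfl, le_rfl⟩,
      fun i j _ _ hij _ sij => absurd (h i j hij sij) (Set.notMem_empty _)⟩⟩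
  obtain ⟨m, hmU, hm⟩ : ∃ m ∈ U, ∀ x ∈ U, FactorsThrough x m → FactorsThrough m x := by
    obtain ⟨m, hm⟩ := (Set.toFinite U).exists_minimalFor
      (fun b : M => {a : M | FactorsThrough a b}) U hne
    refine ⟨m, hm.1, fun x hx hxm => ?_⟩
    have hle : {a : M | FactorsThrough a x} ≤ {a : M | FactorsThrough a m} :=
      fun a ha => FactorsThrough.trans ha hxm
    exact hm.2 hx hle (FactorsThrough.refl m)
  let V : Set M := {x | x ∈ U ∧ ¬ FactorsThrough x m}
  have hVU : V < U := by
    refine Set.ssubset_iff_subset_ne.2 ⟨fun x hx => hx.1, fun h => ?_⟩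
    rw [← h] at hmU
    exact hmU.2 (FactorsThrough.refl m)
  have hV : ∀ x y, x * y ∈ V → x ∈ V ∧ y ∈ V := fun x y h =>
    ⟨⟨(hU x y h.1).1, fun hx => h.2 (FactorsThrough.trans ⟨1, y, by simp⟩ hx)⟩,
      ⟨(hU x y h.1).2, fun hy => h.2 (FactorsThrough.trans ⟨x, 1, by simp⟩ hy)⟩⟩
  obtain ⟨N, hN⟩ := ih V hVU hV
  obtain ⟨K, ⟨ε⟩⟩ := Finite.exists_equiv_fin (M × M)
  refine ⟨N + K + 1, fun f hf s hs hfU => ?_⟩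
  obtain ⟨t, t_mono, t_le, t_t, s_t, t_mem, t_notMem⟩ := exists_block_refinement V hV f hf s hs
  obtain ⟨τ, hτ, hτR⟩ := hN f hf t t_mono t_mem
  have cut_label : ∀ x y, x < y → t x = x → t y = y → s x = s y →
      f x y ∈ U ∧ FactorsThrough (f x y) m := by
    intro x y hxy hx hy sxy
    have h1 := hfU x y hxy sxy
    exact ⟨h1, by_contra fun h => t_notMem x y hxy hx hy sxy ⟨h1, h⟩⟩
  obtain ⟨col, hcol⟩ := exists_coloring_of_factorsThrough f hf s {n | t n = n}
    (fun x => ⟨t x, t_t x, t_le x, s_t x⟩)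
    (fun x hx y hy x' hx' y' hy' hxy hxy' sxy sxy' _ =>
      (cut_label x y hxy hx hy sxy).2.trans
        (hm _ (cut_label x' y' hxy' hx' hy' sxy').1 (cut_label x' y' hxy' hx' hy' sxy').2))
  let σ : ℕ → ℕ := fun n => if t n = n then N + 1 + ε (col n) else τ n
  have σ_cut : ∀ n, t n = n → σ n = N + 1 + ε (col n) := fun n h => if_pos h
  have σ_noncut : ∀ n, t n ≠ n → σ n = τ n := fun n h => if_neg h
  have cut_of_lt : ∀ n, N < σ n → t n = n := by
    intro n h
    by_contra hn
    rw [σ_noncut n hn] at h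
    exact absurd (hτ n).2 (by omega)
  have lt_of_cut : ∀ n, t n = n → N < σ n := by
    intro n h
    rw [σ_cut n h]; omega
  refine ⟨σ, fun n => ?_, ?_⟩
  · by_cases h : t n = n
    · rw [σ_cut n h]
      have := (ε (col n)).isLt
      omega
    · rw [σ_noncut n h]
      have := hτ n
      omega
  intro i j i' j' hij hij' sij sij' sii' eij eij' eii'
  by_cases hi : t i = i
  · have h0 := lt_of_cut i hi
    have hj := cut_of_lt j (eij.1 ▸ h0)
    have hi' := cut_of_lt i' (eii'.1 ▸ h0)
    have hj' := cut_of_lt j' (eij'.1 ▸ eii'.1 ▸ h0)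
    have same_col : ∀ a b, t a = a → t b = b → σ a = σ b → col a = col b := by
      intro a b ha hb h
      rw [σ_cut a ha, σ_cut b hb] at h
      exact ε.injective (Fin.ext (by omega))
    exact hcol i hi j hj i' hi' j' hj' hij hij' sij sij' sii' (same_col _ _ hi hj eij.1)
      (same_col _ _ hi' hj' eij'.1) (same_col _ _ hi hi' eii'.1)
  · have low : σ i ≤ N := by rw [σ_noncut i hi]; exact (hτ i).2
    have transfer : ∀ a b, σ a ≤ N → SplitEquivInf σ a b → t a = t b ∧ SplitEquivInf τ a b := by
      intro a b ha hab
      have nocut : ∀ k, min a b ≤ k → k ≤ max a b → t k ≠ k := fun k h1 h2 hk =>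
        absurd (lt_of_cut k hk) (by have := hab.2 k h1 h2; omega)
      have same : ∀ c d, c ≤ d → (∀ k, c ≤ k → k ≤ d → t k ≠ k) → t c = t d := by
        intro c d hcd hk
        have h1 : t d ≤ c := by
          by_contra h
          exact hk (t d) (by omega) (t_le d) (t_t d)
        have h2 := t_mono h1
        rw [t_t] at h2
        exact le_antisymm (t_mono hcd) h2
      have ea := σ_noncut a (nocut a (by omega) (by omega))
      refine ⟨?_, ?_, fun k h1 h2 => ?_⟩
      · rcases le_total a b with h | h
        · exact same a b h fun k h1 h2 => nocut k (by omega) (by omega)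
        · exact (same b a h fun k h1 h2 => nocut k (by omega) (by omega)).symm
      · rw [← ea, ← σ_noncut b (nocut b (by omega) (by omega))]
        exact hab.1
      · rw [← ea, ← σ_noncut k (nocut k h1 h2)]
        exact hab.2 k h1 h2
    obtain ⟨t1, e1⟩ := transfer i j low eij
    obtain ⟨t2, e2⟩ := transfer i' j' (eii'.1 ▸ low) eij'
    obtain ⟨t3, e3⟩ := transfer i i' low eii'
    exact hτR i j i' j' hij hij' t1 t2 t3 e1 e2 e3

theorem sliceInf_append {A : Type} (w : ℕ → A) {x y z : ℕ} (hxy : x ≤ y) (hyz : y ≤ z) :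
    sliceInf w x z = sliceInf w x y ++ sliceInf w y z := by
  obtain ⟨p, rfl⟩ := Nat.exists_eq_add_of_le hxy
  obtain ⟨q, rfl⟩ := Nat.exists_eq_add_of_le hyz
  have h1 : x + p + q - x = p + q := by omega
  simp only [sliceInf, h1, Nat.add_sub_cancel_left, List.range_add, List.map_append, List.map_map]
  simp [Function.comp_def, add_assoc]

theorem sliceInf_ne_nil {A : Type} (w : ℕ → A) {x y : ℕ} (hxy : x < y) :
    sliceInf w x y ≠ [] := by
  simp only [sliceInf, ne_eq, List.map_eq_nil_iff, List.range_eq_nil]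
  omega

theorem sliceFin_eq_sliceInf {A : Type} (w : List A) (a : A) {i j : ℕ} (hj : j ≤ w.length) :
    sliceFin w i j = sliceInf (fun n => w.getD n a) i j := by
  refine List.ext_getElem ?_ fun n h1 h2 => ?_
  · simp only [sliceFin, sliceInf, List.length_take, List.length_drop, List.length_map,
      List.length_range]
    omega
  · have h3 : i + n < w.length := by
      simp only [sliceInf, List.length_map, List.length_range] at h2
      omega
    simp [sliceFin, sliceInf, h3]

theorem exists_ramsey_split_bound_infinite {A S : Type} [Semigroup S] [Finite S] (φ : List A → S)
    (hφ : ∀ u v : List A, u ≠ [] → v ≠ [] → φ (u ++ v) = φ u * φ v) :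
    ∃ N : ℕ, ∀ w : ℕ → A, ∃ σ : ℕ → ℕ, (∀ i, 1 ≤ σ i ∧ σ i ≤ N) ∧ RamseyInf φ w σ := by
  classical
  have : Finite (WithOne S) := inferInstanceAs (Finite (Option S))
  obtain ⟨N, hN⟩ := exists_ramsey_split_of_labels_mem (M := WithOne S) Set.univ (by simp)
  refine ⟨N, fun w => ?_⟩
  let f : ℕ → ℕ → WithOne S := fun x y => if x < y then (φ (sliceInf w x y) : WithOne S) else 1
  have f_lt : ∀ {x y}, x < y → f x y = (φ (sliceInf w x y) : WithOne S) := fun h => if_pos h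
  have f_self : ∀ x, f x x = 1 := fun x => if_neg (lt_irrefl x)
  obtain ⟨σ, hσ, hR⟩ := hN f (fun x y z hxy hyz => by
    rcases hxy.eq_or_lt with rfl | hxy'
    · rw [f_self, one_mul]
    rcases hyz.eq_or_lt with rfl | hyz'
    · rw [f_self, mul_one]
    rw [f_lt hxy', f_lt hyz', f_lt (hxy'.trans hyz'), sliceInf_append w hxy hyz,
      hφ _ _ (sliceInf_ne_nil w hxy') (sliceInf_ne_nil w hyz'), WithOne.coe_mul])
    (fun _ => 0) monotone_const (fun _ _ _ _ => Set.mem_univ _)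
  refine ⟨σ, hσ, fun i j i' j' hij hij' eij eij' eii' => ?_⟩
  have h := hR i j i' j' hij hij' rfl rfl rfl eij eij' eii'
  rw [f_lt hij, f_lt hij', ← WithOne.coe_mul, WithOne.coe_inj, WithOne.coe_inj] at h
  exact h

/-- **Forest factorization / Ramsey splits.** For every semigroup morphism
`φ : Σ⁺ → S` to a finite semigroup there is a bound `N` such that every finite
or infinite word admits a Ramsey split of height at most `N`. -/
theorem exists_ramsey_split_bound {A S : Type} [Fintype A] [Semigroup S]
    [Fintype S] (φ : List A → S)
    (hφ : ∀ u v : List A, u ≠ [] → v ≠ [] → φ (u ++ v) = φ u * φ v) :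
    ∃ N : ℕ,
      (∀ w : List A, ∃ σ : Fin (w.length + 1) → ℕ,
        (∀ i, 1 ≤ σ i ∧ σ i ≤ N) ∧ RamseyFin φ w σ) ∧
      (∀ w : ℕ → A, ∃ σ : ℕ → ℕ,
        (∀ i, 1 ≤ σ i ∧ σ i ≤ N) ∧ RamseyInf φ w σ) := by
  obtain ⟨N, hN⟩ := exists_ramsey_split_bound_infinite φ hφ
  refine ⟨max N 1, fun w => ?_, fun w => ?_⟩
  · cases w with
    | nil =>
      refine ⟨fun _ => 1, fun _ => ⟨le_rfl, le_max_right _ _⟩, fun i j _ _ hij => ?_⟩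
      have hj := j.isLt
      have hlt := Fin.lt_def.1 hij
      simp only [List.length_nil] at hj
      omega
    | cons a l =>
      obtain ⟨σ, hσ, hR⟩ := hN fun n => (a :: l).getD n a
      refine ⟨fun i => σ i, fun i => ⟨(hσ i).1, (hσ i).2.trans (le_max_left _ _)⟩, ?_⟩
      have equiv : ∀ i j : Fin ((a :: l).length + 1),
          SplitEquivFin (fun i : Fin ((a :: l).length + 1) => σ i) i j →
            SplitEquivInf σ (i : ℕ) (j : ℕ) := by
        refine fun i j h => ⟨h.1, fun k h1 h2 => ?_⟩
        have hi := i.isLt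
        have hj := j.isLt
        refine h.2 ⟨k, by omega⟩ ?_ ?_
        · rcases min_le_iff.1 h1 with h | h
          · exact min_le_iff.2 (Or.inl h)
          · exact min_le_iff.2 (Or.inr h)
        · rcases le_max_iff.1 h2 with h | h
          · exact le_max_iff.2 (Or.inl h)
          · exact le_max_iff.2 (Or.inr h)
      intro i j i' j' hij hij' eij eij' eii'
      rw [sliceFin_eq_sliceInf (a :: l) a (Nat.lt_succ_iff.1 j.isLt),
        sliceFin_eq_sliceInf (a :: l) a (Nat.lt_succ_iff.1 j'.isLt)]
      exact hR i j i' j' hij hij' (equiv _ _ eij) (equiv _ _ eij') (equiv _ _ eii')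
  · obtain ⟨σ, hσ, hR⟩ := hN w
    exact ⟨σ, fun i => ⟨(hσ i).1, (hσ i).2.trans (le_max_left _ _)⟩, hR⟩
end
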